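/- arXiv:2302.10052 — 4 statements merged into one kernel-verified Lean document; each statement's English description precedes it below -/
import Mathlib

section
/- (Bryant) Let m ≥ 2 and let G be a nontrivial finite subgroup of GL_m(K) acting on the free Lie algebra L_m on x_1,…,x_m. Then the fixed-point subalgebra L_m^G = {f ∈ L_m : g(f) = f for all g ∈ G} is not finitely generated as a Lie algebra. -/
open Matrix

/-- The action of a matrix `g` on the free Lie algebra `L_m` by linear substitution of the
free generators: `x_j ↦ ∑ i, g i j • x_i`. -/
noncomputable def lieAct (K : Type*) [Field K] {m : ℕ}
    (g : Matrix (Fin m) (Fin m) K) :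
    FreeLieAlgebra K (Fin m) →ₗ⁅K⁆ FreeLieAlgebra K (Fin m) :=
  FreeLieAlgebra.lift K fun j => ∑ i, g i j • FreeLieAlgebra.of K i

/-! ### The metabelian Lie algebra of a commutative algebra -/

/-- The semidirect sum `Q ⋉ Q` of a commutative ring `Q`, regarded as an abelian Lie ring, acting
on itself by multiplication. -/
@[ext]
structure Metabelian (Q : Type*) where
  /-- The acting component. -/
  fst : Q
  /-- The component in the abelian ideal. -/
  snd : Q

namespace Metabelian

/-- The underlying pair. -/
def toProd {Q : Type*} (x : Metabelian Q) : Q × Q := (x.fst, x.snd)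

theorem toProd_injective {Q : Type*} : Function.Injective (toProd : Metabelian Q → Q × Q) := by
  rintro ⟨a, b⟩ ⟨c, d⟩ h
  simpa [toProd] using h

variable {K Q : Type*} [Field K] [CommRing Q] [Algebra K Q]

instance : Zero (Metabelian Q) := ⟨⟨0, 0⟩⟩
instance : Add (Metabelian Q) := ⟨fun x y => ⟨x.fst + y.fst, x.snd + y.snd⟩⟩
instance : Neg (Metabelian Q) := ⟨fun x => ⟨-x.fst, -x.snd⟩⟩
instance : Sub (Metabelian Q) := ⟨fun x y => ⟨x.fst - y.fst, x.snd - y.snd⟩⟩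
instance {S : Type*} [SMul S Q] : SMul S (Metabelian Q) := ⟨fun t x => ⟨t • x.fst, t • x.snd⟩⟩
instance : Bracket (Metabelian Q) (Metabelian Q) :=
  ⟨fun x y => ⟨0, x.fst * y.snd - y.fst * x.snd⟩⟩

@[simp] theorem fst_zero : (0 : Metabelian Q).fst = 0 := rfl
@[simp] theorem snd_zero : (0 : Metabelian Q).snd = 0 := rfl
@[simp] theorem fst_add (x y : Metabelian Q) : (x + y).fst = x.fst + y.fst := rfl
@[simp] theorem snd_add (x y : Metabelian Q) : (x + y).snd = x.snd + y.snd := rfl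
@[simp] theorem fst_smul (t : K) (x : Metabelian Q) : (t • x).fst = t • x.fst := rfl
@[simp] theorem snd_smul (t : K) (x : Metabelian Q) : (t • x).snd = t • x.snd := rfl
@[simp] theorem fst_lie (x y : Metabelian Q) : ⁅x, y⁆.fst = 0 := rfl
@[simp] theorem snd_lie (x y : Metabelian Q) :
    ⁅x, y⁆.snd = x.fst * y.snd - y.fst * x.snd := rfl

instance : AddCommGroup (Metabelian Q) :=
  toProd_injective.addCommGroup _ rfl (fun _ _ => rfl) (fun _ => rfl) (fun _ _ => rfl)
    (fun _ _ => rfl) (fun _ _ => rfl)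

instance : Module K (Metabelian Q) :=
  toProd_injective.module K ⟨⟨toProd, rfl⟩, fun _ _ => rfl⟩ (fun _ _ => rfl)

instance : LieRing (Metabelian Q) where
  add_lie x y z := by ext <;> simp; ring
  lie_add x y z := by ext <;> simp; ring
  lie_self x := by ext <;> simp
  leibniz_lie x y z := by ext <;> simp; ring

instance : LieAlgebra K (Metabelian Q) where
  lie_smul t x y := by ext <;> simp [smul_sub]

/-- Functoriality of `Metabelian` in the commutative algebra. -/
def map (f : Q →ₐ[K] Q) : Metabelian Q →ₗ⁅K⁆ Metabelian Q where
  toFun x := ⟨f x.fst, f x.snd⟩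
  map_add' x y := by ext <;> simp
  map_smul' t x := by ext <;> simp
  map_lie' {x y} := by ext <;> simp

@[simp] theorem fst_map (f : Q →ₐ[K] Q) (x : Metabelian Q) : (map f x).fst = f x.fst := rfl
@[simp] theorem snd_map (f : Q →ₐ[K] Q) (x : Metabelian Q) : (map f x).snd = f x.snd := rfl

/-- The second projection as a linear map. -/
def sndₗ : Metabelian Q →ₗ[K] Q where
  toFun := snd
  map_add' _ _ := rfl
  map_smul' _ _ := rfl

/-- For a subalgebra `A` and an `A`-submodule `N`, the pairs in `A × N` form a Lie subalgebra. -/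
def subalgebraOf (A : Subalgebra K Q) (N : Submodule A Q) :
    LieSubalgebra K (Metabelian Q) where
  carrier := {x | x.fst ∈ A ∧ x.snd ∈ N}
  zero_mem' := ⟨A.zero_mem, N.zero_mem⟩
  add_mem' hx hy := ⟨A.add_mem hx.1 hy.1, N.add_mem hx.2 hy.2⟩
  smul_mem' t x hx := by
    refine ⟨A.smul_mem hx.1 t, ?_⟩
    have := N.smul_mem (algebraMap K A t) hx.2
    rwa [algebraMap_smul] at this
  lie_mem' {x y} hx hy := by
    refine ⟨A.zero_mem, ?_⟩
    have h₁ := N.smul_mem ⟨x.fst, hx.1⟩ hy.2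
    have h₂ := N.smul_mem ⟨y.fst, hy.1⟩ hx.2
    exact N.sub_mem h₁ h₂

/-- The Lie subalgebra of pairs whose first component lies in a given subspace. -/
def fstMem (U : Submodule K Q) : LieSubalgebra K (Metabelian Q) where
  carrier := {x | x.fst ∈ U}
  zero_mem' := U.zero_mem
  add_mem' hx hy := U.add_mem hx hy
  smul_mem' t _ hx := U.smul_mem t hx
  lie_mem' _ _ := U.zero_mem

end Metabelian

/-! ### Linear substitutions -/

section Substitution

variable {K : Type*} [Field K] {m : ℕ}

theorem lieAct_of (g : Matrix (Fin m) (Fin m) K) (j : Fin m) :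
    lieAct K g (FreeLieAlgebra.of K j) = ∑ i, g i j • FreeLieAlgebra.of K i := by
  simp [lieAct]

theorem lieAct_mul (g h : Matrix (Fin m) (Fin m) K) (y : FreeLieAlgebra K (Fin m)) :
    lieAct K (g * h) y = lieAct K g (lieAct K h y) := by
  suffices H : lieAct K (g * h) = (lieAct K g).comp (lieAct K h) by rw [H]; rfl
  ext j
  simp only [LieHom.comp_apply, lieAct_of, map_sum, map_smul, Matrix.mul_apply, Finset.sum_smul,
    Finset.smul_sum, smul_smul]
  rw [Finset.sum_comm]
  simp only [mul_comm]

theorem FreeLieAlgebra.mem_of_forall_of_mem {X : Type*}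
    (H : LieSubalgebra K (FreeLieAlgebra K X)) (h : ∀ x, FreeLieAlgebra.of K x ∈ H)
    (y : FreeLieAlgebra K X) : y ∈ H := by
  have key : H.incl.comp (FreeLieAlgebra.lift K fun x => (⟨_, h x⟩ : H)) = LieHom.id := by
    ext x; simp
  have := LieHom.congr_fun key y
  simp only [LieHom.comp_apply, LieHom.id_apply] at this
  rw [← this]
  exact Subtype.property _

/-- Polynomials in two copies of the variables `x_1, …, x_m`. -/
abbrev DoublePoly (K : Type*) [Field K] (m : ℕ) := MvPolynomial (Fin 2 × Fin m) K

/-- The diagonal linear substitution by a matrix on polynomials in two copies of the variables. -/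
noncomputable def polyAct (g : Matrix (Fin m) (Fin m) K) : DoublePoly K m →ₐ[K] DoublePoly K m :=
  MvPolynomial.aeval fun a => ∑ i, g i a.2 • MvPolynomial.X (a.1, i)

theorem polyAct_X (g : Matrix (Fin m) (Fin m) K) (a : Fin 2) (j : Fin m) :
    polyAct g (MvPolynomial.X (a, j)) = ∑ i, g i j • MvPolynomial.X (a, i) := by
  simp [polyAct]

theorem polyAct_mul (g h : Matrix (Fin m) (Fin m) K) (p : DoublePoly K m) :
    polyAct (g * h) p = polyAct g (polyAct h p) := by
  suffices H : polyAct (g * h) = (polyAct g).comp (polyAct h) by rw [H]; rfl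
  ext1 ⟨a, j⟩
  simp only [AlgHom.comp_apply, polyAct_X, map_sum, map_smul, Matrix.mul_apply, Finset.sum_smul,
    Finset.smul_sum, smul_smul]
  rw [Finset.sum_comm]
  simp only [mul_comm]

theorem polyAct_one (p : DoublePoly K m) : polyAct 1 p = p := by
  suffices H : polyAct (1 : Matrix (Fin m) (Fin m) K) = AlgHom.id K _ by rw [H]; rfl
  ext1 ⟨a, j⟩
  simp [polyAct_X, Matrix.one_apply, ite_smul]

theorem sum_smul_X_injective {v w : Fin m → K} {a : Fin 2}
    (h : ∑ i, v i • (MvPolynomial.X (a, i) : DoublePoly K m) =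
      ∑ i, w i • MvPolynomial.X (a, i)) : v = w := by
  funext k
  have := congrArg (MvPolynomial.aeval (fun b : Fin 2 × Fin m => if b.2 = k then (1 : K) else 0)) h
  simpa using this

/-- The Magnus-type representation `x_j ↦ (X_{0j}, X_{1j})` of the free Lie algebra. -/
noncomputable def magnus (K : Type*) [Field K] (m : ℕ) :
    FreeLieAlgebra K (Fin m) →ₗ⁅K⁆ Metabelian (DoublePoly K m) :=
  FreeLieAlgebra.lift K fun j => ⟨MvPolynomial.X (0, j), MvPolynomial.X (1, j)⟩

theorem magnus_of (j : Fin m) : magnus K m (FreeLieAlgebra.of K j) =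
    ⟨MvPolynomial.X (0, j), MvPolynomial.X (1, j)⟩ := by
  simp [magnus]

theorem Metabelian.sum_smul_mk {ι Q : Type*} [CommRing Q] [Algebra K Q] (s : Finset ι)
    (c : ι → K) (p q : ι → Q) :
    ∑ i ∈ s, c i • (⟨p i, q i⟩ : Metabelian Q) = ⟨∑ i ∈ s, c i • p i, ∑ i ∈ s, c i • q i⟩ := by
  classical
  induction s using Finset.induction_on with
  | empty => rfl
  | insert i s hi ih => rw [Finset.sum_insert hi, ih]; ext <;> simp [Finset.sum_insert hi]

theorem magnus_lieAct (g : Matrix (Fin m) (Fin m) K) (y : FreeLieAlgebra K (Fin m)) :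
    magnus K m (lieAct K g y) = Metabelian.map (polyAct g) (magnus K m y) := by
  suffices H : (magnus K m).comp (lieAct K g) = (Metabelian.map (polyAct g)).comp (magnus K m) from
    LieHom.congr_fun H y
  ext1 j
  simp only [LieHom.comp_apply, lieAct_of, map_sum, map_smul, magnus_of]
  rw [Metabelian.sum_smul_mk]
  ext1 <;> simp [polyAct_X]

/-- The linear forms in the first copy of the variables. -/
noncomputable def linearForms (K : Type*) [Field K] (m : ℕ) : Submodule K (DoublePoly K m) :=
  Submodule.span K (Set.range fun j => MvPolynomial.X (0, j))

theorem magnus_fst_mem (y : FreeLieAlgebra K (Fin m)) :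
    (magnus K m y).fst ∈ linearForms K m :=
  FreeLieAlgebra.mem_of_forall_of_mem
    ((Metabelian.fstMem (linearForms K m)).comap (magnus K m))
    (fun j => by
      change (magnus K m _).fst ∈ linearForms K m
      rw [magnus_of]
      exact Submodule.subset_span ⟨j, rfl⟩) y

/-- The polynomials in the first copy of the variables. -/
noncomputable def firstPolys (K : Type*) [Field K] (m : ℕ) : Subalgebra K (DoublePoly K m) :=
  Algebra.adjoin K (Set.range fun j => MvPolynomial.X (0, j))

theorem X_mem_firstPolys (j : Fin m) :
    (MvPolynomial.X (0, j) : DoublePoly K m) ∈ firstPolys K m :=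
  Algebra.subset_adjoin ⟨j, rfl⟩

theorem polyAct_X_mem_firstPolys (g : Matrix (Fin m) (Fin m) K) (j : Fin m) :
    polyAct g (MvPolynomial.X (0, j)) ∈ firstPolys K m := by
  rw [polyAct_X]
  exact Subalgebra.sum_mem _ fun i _ => Subalgebra.smul_mem _ (X_mem_firstPolys i) _

/-- The set of `q` with `(0, q)` in the image of the Magnus representation is stable under
multiplication by polynomials in the first copy of the variables. -/
theorem exists_magnus_eq_mul {q : DoublePoly K m} (hq : ∃ y, magnus K m y = ⟨0, q⟩)
    {p : DoublePoly K m} (hp : p ∈ firstPolys K m) : ∃ y, magnus K m y = ⟨0, p * q⟩ := by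
  induction hp using Algebra.adjoin_induction generalizing q with
  | mem x hx =>
    obtain ⟨j, rfl⟩ := hx
    obtain ⟨y, hy⟩ := hq
    refine ⟨⁅FreeLieAlgebra.of K j, y⁆, ?_⟩
    rw [LieHom.map_lie, hy, magnus_of]
    ext1 <;> simp
  | algebraMap t =>
    obtain ⟨y, hy⟩ := hq
    refine ⟨t • y, ?_⟩
    rw [map_smul, hy]
    ext1 <;> simp [Algebra.smul_def]
  | add p p' _ _ ihp ihp' =>
    obtain ⟨y, hy⟩ := ihp hq
    obtain ⟨y', hy'⟩ := ihp' hq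
    refine ⟨y + y', ?_⟩
    rw [map_add, hy, hy']
    ext1 <;> simp [add_mul]
  | mul p p' _ _ ihp ihp' =>
    rw [mul_assoc]
    exact ihp (ihp' hq)

end Substitution

/-! ### Finite groups of linear substitutions -/

section FiniteGroup

variable {K : Type*} [Field K] {m : ℕ} {G : Subgroup (GL (Fin m) K)}

/-- Dedekind's independence of characters: some multiple of a nonzero polynomial has nonzero
average over a finite group. -/
theorem exists_sum_polyAct_mul_ne_zero [Fintype G] {c : DoublePoly K m} (hc : c ≠ 0) :
    ∃ p ∈ firstPolys K m, ∑ g : G, polyAct (g : GL (Fin m) K).val (p * c) ≠ 0 := by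
  by_contra! H
  let χ : G → (firstPolys K m →* DoublePoly K m) := fun g =>
    ((polyAct (g : GL (Fin m) K).val).comp (firstPolys K m).val : _ →ₐ[K] _)
  have hχ : Function.Injective χ := by
    intro g h hgh
    apply Subtype.ext
    apply Units.ext
    ext i j
    have := DFunLike.congr_fun hgh ⟨_, X_mem_firstPolys j⟩
    change polyAct _ (MvPolynomial.X (0, j)) = polyAct _ (MvPolynomial.X (0, j)) at this
    rw [polyAct_X, polyAct_X] at this
    exact congrFun (sum_smul_X_injective (v := fun i => (g : GL (Fin m) K).val i j)
      (w := fun i => (h : GL (Fin m) K).val i j) this) i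
  have hind := (linearIndependent_monoidHom (firstPolys K m) (DoublePoly K m)).comp χ hχ
  rw [Fintype.linearIndependent_iff] at hind
  have h1 := hind (fun g => polyAct (g : GL (Fin m) K).val c) (by
    funext p
    have := H p p.2
    simp only [map_mul] at this
    simp only [Finset.sum_apply, Pi.smul_apply, smul_eq_mul, Pi.zero_apply, Function.comp]
    rw [← this]
    exact Finset.sum_congr rfl fun g _ => mul_comm _ _) 1
  exact hc (by simpa [polyAct_one] using h1)

/-- The polynomial `X_{0i} X_{1j} - X_{0j} X_{1i}`, the image of `[x_i, x_j]`, is nonzero. -/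
theorem X_mul_X_sub_ne_zero {i j : Fin m} (hij : i ≠ j) :
    (MvPolynomial.X (0, i) * MvPolynomial.X (1, j) -
      MvPolynomial.X (0, j) * MvPolynomial.X (1, i) : DoublePoly K m) ≠ 0 := by
  intro h
  have := congrArg (MvPolynomial.aeval
    (fun b : Fin 2 × Fin m => if b = (0, i) ∨ b = (1, j) then (1 : K) else 0)) h
  simp [hij, hij.symm] at this

/-- A root of a monic polynomial with integral coefficients is integral. -/
theorem isIntegral_of_monic_of_coeff {A B : Type*} [CommRing A] [CommRing B] [Algebra A B]
    {P : Polynomial B} (hP : P.Monic) (hcoeff : ∀ n, IsIntegral A (P.coeff n)) {x : B}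
    (hx : P.eval x = 0) : IsIntegral A x := by
  nontriviality B
  have hlift : P ∈ Polynomial.lifts (algebraMap (integralClosure A B) B) :=
    (Polynomial.lifts_iff_coeff_lifts P).2 fun n => ⟨⟨_, hcoeff n⟩, rfl⟩
  obtain ⟨R, hR, -, hRmonic⟩ := Polynomial.lifts_and_degree_eq_and_monic hlift hP
  have hint : IsIntegral (integralClosure A B) x :=
    ⟨R, hRmonic, by rw [← Polynomial.eval_map, hR, hx]⟩
  exact isIntegral_trans x hint

/-- The variables of the first copy are integral over any subalgebra over which all
invariant polynomials in them are integral. -/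
theorem isIntegral_X_of_invariants [Fintype G] {A : Subalgebra K (DoublePoly K m)}
    (hA : ∀ f ∈ firstPolys K m, (∀ g ∈ G, polyAct g.val f = f) → IsIntegral A f) (j : Fin m) :
    IsIntegral A (MvPolynomial.X (0, j) : DoublePoly K m) := by
  let P : Polynomial (DoublePoly K m) :=
    ∏ g : G, (Polynomial.X - Polynomial.C (polyAct (g : GL (Fin m) K).val (MvPolynomial.X (0, j))))
  have hmonic : P.Monic := Polynomial.monic_prod_X_sub_C _ _
  have hmem : ∀ n, P.coeff n ∈ firstPolys K m := by
    have : P ∈ Polynomial.liftsRing (algebraMap (firstPolys K m) (DoublePoly K m)) := by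
      refine Subring.prod_mem _ fun g _ => Subring.sub_mem _ ?_ ?_
      · exact Polynomial.X_mem_lifts _
      · exact Polynomial.C_mem_lifts _ (⟨_, polyAct_X_mem_firstPolys _ _⟩ : firstPolys K m)
    intro n
    obtain ⟨y, hy⟩ := (Polynomial.lifts_iff_coeff_lifts P).1 this n
    rw [← hy]
    exact y.2
  have hinv : ∀ n, ∀ g ∈ G, polyAct g.val (P.coeff n) = P.coeff n := by
    intro n g hg
    have : P.map (polyAct g.val : DoublePoly K m →+* DoublePoly K m) = P := by
      simp only [P, Polynomial.map_prod, Polynomial.map_sub, Polynomial.map_X, Polynomial.map_C,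
        RingHom.coe_coe, ← polyAct_mul]
      exact Fintype.prod_equiv (Equiv.mulLeft (⟨g, hg⟩ : G)) _ _ fun _ => rfl
    conv_rhs => rw [← this, Polynomial.coeff_map]
    rfl
  have hroot : P.eval (MvPolynomial.X (0, j)) = 0 := by
    rw [Polynomial.eval_prod]
    refine Finset.prod_eq_zero (Finset.mem_univ (1 : G)) ?_
    simp [polyAct_one]
  exact isIntegral_of_monic_of_coeff hmonic (fun n => hA _ (hmem n) (hinv n)) hroot

/-- If a nontrivial matrix `h` fixes all the linear forms in a set `T`, then some variable is not
integral over the subalgebra generated by `T`. -/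
theorem exists_not_isIntegral_X {h : Matrix (Fin m) (Fin m) K} (hh : h ≠ 1)
    {T : Set (DoublePoly K m)} (hT : ∀ p ∈ T, p ∈ linearForms K m ∧ polyAct h p = p) :
    ∃ j, ¬ IsIntegral (Algebra.adjoin K T) (MvPolynomial.X (0, j) : DoublePoly K m) := by
  obtain ⟨i, j, hij⟩ : ∃ i j, h i j ≠ (1 : Matrix (Fin m) (Fin m) K) i j := by
    by_contra! H
    exact hh (Matrix.ext H)
  let c : Fin m → K := fun k => (1 : Matrix (Fin m) (Fin m) K) i k - h i k
  let ψ : DoublePoly K m →ₐ[K] Polynomial K :=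
    MvPolynomial.aeval fun b => c b.2 • Polynomial.X
  let ψ₀ : DoublePoly K m →ₐ[K] Polynomial K :=
    MvPolynomial.aeval fun b => (1 : Matrix (Fin m) (Fin m) K) i b.2 • Polynomial.X
  have hψ : ∀ p ∈ linearForms K m, ψ p = ψ₀ p - ψ₀ (polyAct h p) := by
    have := LinearMap.eqOn_span (f := ψ.toLinearMap)
      (g := ψ₀.toLinearMap - ψ₀.toLinearMap ∘ₗ (polyAct h).toLinearMap)
      (s := Set.range fun j => (MvPolynomial.X (0, j) : DoublePoly K m)) (by
        rintro _ ⟨k, rfl⟩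
        simp [ψ, ψ₀, c, polyAct_X, Matrix.one_apply, sub_smul])
    exact fun p hp => this hp
  have hψA : ∀ a ∈ Algebra.adjoin K T, Polynomial.C ((ψ a).eval 0) = ψ a := by
    intro a ha
    induction ha using Algebra.adjoin_induction with
    | mem p hp => rw [hψ p (hT p hp).1, (hT p hp).2]; simp
    | algebraMap t => simp [Polynomial.algebraMap_eq]
    | add p q _ _ hp hq => simp [hp, hq]
    | mul p q _ _ hp hq => simp [hp, hq]
  refine ⟨j, fun hint => ?_⟩
  have h1 : IsIntegral K (ψ (MvPolynomial.X (0, j))) :=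
    hint.map_of_comp_eq
      ((Polynomial.evalRingHom (0 : K)).comp
        ((ψ : DoublePoly K m →+* Polynomial K).comp (algebraMap (Algebra.adjoin K T) _)))
      (ψ : DoublePoly K m →+* Polynomial K) (by
        ext1 a
        exact hψA a a.2)
  have hc : c j ≠ 0 := sub_ne_zero.2 hij.symm
  have h2 : IsIntegral K (Polynomial.X : Polynomial K) := by
    have := h1.smul (c j)⁻¹
    simpa [ψ, smul_smul, hc] using this
  exact Polynomial.transcendental_X K h2.isAlgebraic

end FiniteGroup

/-- **Bryant.** For `m ≥ 2` and a nontrivial finite subgroup `G ≤ GL_m(K)`, the fixed-point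
subalgebra `L_m^G` of the free Lie algebra is not finitely generated as a Lie algebra: it is
not the Lie subalgebra generated by any finite set. -/
theorem bryant_not_finitely_generated {K : Type*} [Field K] [IsAlgClosed K] [CharZero K]
    {m : ℕ} (hm : 2 ≤ m) (G : Subgroup (GL (Fin m) K)) [Finite G] (hG : G ≠ ⊥) :
    ¬ ∃ s : Finset (FreeLieAlgebra K (Fin m)),
        ∀ y : FreeLieAlgebra K (Fin m),
          (∀ g ∈ G, lieAct K ((g : GL (Fin m) K) : Matrix (Fin m) (Fin m) K) y = y) ↔
            y ∈ LieSubalgebra.lieSpan K (FreeLieAlgebra K (Fin m)) ↑s := by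
  rintro ⟨s, hs⟩
  have := Fintype.ofFinite G
  have hfix : ∀ y ∈ s, ∀ g ∈ G, lieAct K g.val y = y := fun y hy =>
    (hs y).2 (LieSubalgebra.subset_lieSpan hy)
  let T : Set (DoublePoly K m) := (fun y => (magnus K m y).fst) '' s
  let A : Subalgebra K (DoublePoly K m) := Algebra.adjoin K T
  let N : Submodule A (DoublePoly K m) := Submodule.span A ((fun y => (magnus K m y).snd) '' s)
  have hAnoeth : IsNoetherianRing A := by
    have : A.FG := Subalgebra.fg_def.2 ⟨T, s.finite_toSet.image _, rfl⟩
    have : Algebra.FiniteType K A := A.fg_iff_finiteType.1 this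
    exact Algebra.FiniteType.isNoetherianRing K A
  have hNnoeth : IsNoetherian A N := isNoetherian_span_of_finite A (s.finite_toSet.image _)
  have hsnd : ∀ y, (∀ g ∈ G, lieAct K g.val y = y) → (magnus K m y).snd ∈ N := by
    intro y hy
    have hle : LieSubalgebra.lieSpan K _ ↑s ≤
        (Metabelian.subalgebraOf A N).comap (magnus K m) :=
      LieSubalgebra.lieSpan_le.2 fun z hz =>
        ⟨Algebra.subset_adjoin ⟨z, hz, rfl⟩, Submodule.subset_span ⟨z, hz, rfl⟩⟩
    exact (hle ((hs y).1 hy)).2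
  have hsum : ∀ q, (∃ y, magnus K m y = ⟨0, q⟩) →
      ∑ g : G, polyAct (g : GL (Fin m) K).val q ∈ N := by
    rintro q ⟨y, hy⟩
    have h1 := hsnd (∑ g : G, lieAct K (g : GL (Fin m) K).val y) (by
      intro h hh
      simp only [map_sum, ← lieAct_mul]
      exact Fintype.sum_equiv (Equiv.mulLeft (⟨h, hh⟩ : G)) _ _ fun _ => rfl)
    have h2 : (magnus K m (∑ g : G, lieAct K (g : GL (Fin m) K).val y)).snd =
        ∑ g : G, polyAct (g : GL (Fin m) K).val q := by
      change Metabelian.sndₗ (K := K) _ = _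
      simp only [map_sum, magnus_lieAct, hy]
      rfl
    rwa [h2] at h1
  let i : Fin m := ⟨0, by omega⟩
  let j : Fin m := ⟨1, by omega⟩
  let c : DoublePoly K m := MvPolynomial.X (0, i) * MvPolynomial.X (1, j) -
    MvPolynomial.X (0, j) * MvPolynomial.X (1, i)
  have hcm : ∃ y, magnus K m y = ⟨0, c⟩ :=
    ⟨⁅FreeLieAlgebra.of K i, FreeLieAlgebra.of K j⁆, by
      rw [LieHom.map_lie, magnus_of, magnus_of]; rfl⟩
  obtain ⟨p, hp, hu⟩ := exists_sum_polyAct_mul_ne_zero (G := G)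
    (X_mul_X_sub_ne_zero (K := K) (show i ≠ j by simp [i, j]))
  let u : DoublePoly K m := ∑ g : G, polyAct (g : GL (Fin m) K).val (p * c)
  let I : Set (DoublePoly K m) := {f | f ∈ firstPolys K m ∧ ∀ g ∈ G, polyAct g.val f = f}
  let N' : Submodule A (DoublePoly K m) := Submodule.span A ((fun f => f * u) '' I)
  have hN' : N' ≤ N := by
    refine Submodule.span_le.2 ?_
    rintro _ ⟨f, ⟨hf, hfG⟩, rfl⟩
    have := hsum _ (exists_magnus_eq_mul hcm ((firstPolys K m).mul_mem hf hp))
    have heq : f * u = ∑ g : G, polyAct (g : GL (Fin m) K).val (f * p * c) := by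
      rw [Finset.mul_sum]
      exact Finset.sum_congr rfl fun g _ => by rw [mul_assoc f, map_mul _ f, hfG _ g.2]
    change f * u ∈ N
    rwa [heq]
  have hN'ne : N' ≠ ⊥ := by
    refine (Submodule.ne_bot_iff _).2 ⟨u, Submodule.subset_span ⟨1, ⟨?_, ?_⟩, one_mul u⟩, hu⟩
    · exact (firstPolys K m).one_mem
    · exact fun g _ => map_one (polyAct g.val)
  have hint : ∀ f ∈ firstPolys K m, (∀ g ∈ G, polyAct g.val f = f) → IsIntegral A f := by
    intro f hf hfG
    refine isIntegral_of_smul_mem_submodule N' hN'ne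
      (Submodule.FG.of_le_of_isNoetherian hN') f fun n hn => ?_
    induction hn using Submodule.span_induction with
    | mem x hx =>
      obtain ⟨f', ⟨hf', hf'G⟩, rfl⟩ := hx
      refine Submodule.subset_span ⟨f * f', ⟨(firstPolys K m).mul_mem hf hf', fun g hg => ?_⟩, ?_⟩
      · rw [map_mul, hfG g hg, hf'G g hg]
      · simp [mul_assoc]
    | zero => simp
    | add x y _ _ hx hy => rw [smul_add]; exact N'.add_mem hx hy
    | smul a x _ hx => rw [smul_comm]; exact N'.smul_mem a hx
  obtain ⟨⟨h, hhG⟩, hne⟩ := G.ne_bot_iff_exists_ne_one.1 hG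
  have hh : h.val ≠ 1 := fun h1 => hne (Subtype.ext (Units.ext h1))
  obtain ⟨k, hk⟩ := exists_not_isIntegral_X hh (T := T) (by
    rintro _ ⟨y, hy, rfl⟩
    refine ⟨magnus_fst_mem y, ?_⟩
    have := magnus_lieAct h.val y
    rw [hfix y hy _ hhG] at this
    exact (congrArg Metabelian.fst this).symm)
  exact hk (isIntegral_X_of_invariants hint k)
end

section
/- (Dubnov–Ivanov–Nagata–Higman) For every positive integer k there exists a positive integer d = d(k), depending only on k, with the following property: if R is a (not necessarily unital) associative algebra over a field K of characteristic 0 such that r^k = 0 for every r ∈ R, then R is nilpotent of class d, i.e. every product of d elements of R is zero. -/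
universe u v

open Polynomial in
/-- Vandermonde argument: a polynomial all of whose values at scalars lie in a subspace has
its coefficients in that subspace. -/
theorem Submodule.coeff_mem_of_forall_eval_mem {K A : Type*} [Field K] [Infinite K] [Ring A]
    [Algebra K A] (J : Submodule K A) (p : A[X])
    (h : ∀ t : K, p.eval (algebraMap K A t) ∈ J) (i : ℕ) : p.coeff i ∈ J := by
  by_contra hi
  obtain ⟨f, hf, hJ⟩ := J.exists_le_ker_of_notMem hi
  let q : K[X] := ∑ j ∈ Finset.range (p.natDegree + 1), monomial j (f (p.coeff j))
  have hq : q = 0 := by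
    refine Polynomial.funext fun t => ?_
    have ht : f (p.eval (algebraMap K A t)) = 0 := hJ (h t)
    rw [eval_eq_sum_range, map_sum] at ht
    simp only [q, eval_finsetSum, eval_monomial, eval_zero]
    rw [← ht]
    refine Finset.sum_congr rfl fun j _ => ?_
    rw [← map_pow, ← Algebra.commutes, ← Algebra.smul_def, map_smul, smul_eq_mul, mul_comm]
  have hc : q.coeff i = f (p.coeff i) := by
    simp only [q, finsetSum_coeff, coeff_monomial, Finset.sum_ite_eq', Finset.mem_range]
    split_ifs with hlt
    · rfl
    · rw [coeff_eq_zero_of_natDegree_lt (by omega), map_zero]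
  exact hf (by rw [← hc, hq, coeff_zero])

open Polynomial in
theorem Polynomial.coeff_one_C_add_C_mul_X_pow {A : Type*} [Ring A] (x y : A) (m : ℕ) :
    ((C x + C y * X) ^ m).coeff 1 = ∑ i ∈ Finset.range m, x ^ i * y * x ^ (m - 1 - i) := by
  induction m with
  | zero => simp [coeff_one]
  | succ m ih =>
    have h0 : ((C x + C y * X) ^ m).coeff 0 = x ^ m := by
      rw [← constantCoeff_apply, map_pow]
      simp
    rw [pow_succ, mul_coeff_one, ih, h0, Finset.sum_range_succ, Finset.sum_mul, add_comm]
    congr 1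
    · refine Finset.sum_congr rfl fun i hi => ?_
      rw [Finset.mem_range] at hi
      rw [coeff_add, coeff_C_zero, mul_coeff_zero, coeff_X_zero, mul_zero, add_zero, mul_assoc,
        ← pow_succ]
      congr 2
      omega
    · simp [coeff_C]

section NagataHigman

variable {K A : Type*} [Field K] [CharZero K] [Ring A] [Algebra K A]

/-- Partial linearization of the identity `x ^ (n + 1) = 0` modulo `J`. -/
theorem Submodule.sum_pow_mul_mul_pow_mem {M J : Submodule K A} {n : ℕ}
    (h : ∀ x ∈ M, x ^ (n + 1) ∈ J) {x y : A} (hx : x ∈ M) (hy : y ∈ M) :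
    ∑ i ∈ Finset.range (n + 1), x ^ i * y * x ^ (n - i) ∈ J := by
  have key := J.coeff_mem_of_forall_eval_mem
    ((Polynomial.C x + Polynomial.C y * Polynomial.X) ^ (n + 1)) (fun t => ?_) 1
  · simpa only [Polynomial.coeff_one_C_add_C_mul_X_pow, Nat.add_sub_cancel] using key
  · have hev (p : Polynomial A) (m : ℕ) : (p ^ m).eval (algebraMap K A t) =
        p.eval (algebraMap K A t) ^ m :=
      map_pow (Polynomial.eval₂RingHom' (RingHom.id A) (algebraMap K A t)
        fun a => (Algebra.commutes t a).symm) p m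
    rw [hev, Polynomial.eval_add, Polynomial.eval_C, Polynomial.eval_C_mul, Polynomial.eval_X,
      ← Algebra.commutes, ← Algebra.smul_def]
    exact h _ (M.add_mem hx (M.smul_mem t hy))

/-- Higman's identity: `x ^ (n + 1) = 0` implies `x ^ n * z * y ^ n = 0`, modulo `J`. -/
theorem Submodule.pow_mul_mul_pow_mem {M J : Submodule K A} (hM : M * ⊤ ≤ M)
    (hJl : ⊤ * J ≤ J) (hJr : J * ⊤ ≤ J) {n : ℕ} (h : ∀ x ∈ M, x ^ (n + 1) ∈ J) {x y z : A}
    (hx : x ∈ M) (hy : y ∈ M) (hz : z ∈ M) : x ^ n * z * y ^ n ∈ J := by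
  have hsum : ∑ j ∈ Finset.range (n + 1),
      (∑ i ∈ Finset.range (n + 1), x ^ i * (z * y ^ j) * x ^ (n - i)) * y ^ (n - j) ∈ J :=
    J.sum_mem fun j _ => hJr <| mul_mem_mul
      (sum_pow_mul_mul_pow_mem h hx (hM (mul_mem_mul hz mem_top))) mem_top
  have hswap : ∑ j ∈ Finset.range (n + 1),
      (∑ i ∈ Finset.range (n + 1), x ^ i * (z * y ^ j) * x ^ (n - i)) * y ^ (n - j) =
      ∑ i ∈ Finset.range (n + 1),
        x ^ i * z * ∑ j ∈ Finset.range (n + 1), y ^ j * x ^ (n - i) * y ^ (n - j) := by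
    simp only [Finset.sum_mul, Finset.mul_sum]
    rw [Finset.sum_comm]
    simp only [mul_assoc]
  rw [hswap, Finset.sum_range_succ] at hsum
  have hlow : ∑ i ∈ Finset.range n,
      x ^ i * z * ∑ j ∈ Finset.range (n + 1), y ^ j * x ^ (n - i) * y ^ (n - j) ∈ J := by
    refine J.sum_mem fun i hi => hJl <| mul_mem_mul mem_top ?_
    refine sum_pow_mul_mul_pow_mem h hy ?_
    obtain ⟨m, hm⟩ := Nat.exists_eq_add_of_lt (Finset.mem_range.mp hi)
    rw [show n - i = m + 1 by omega, pow_succ']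
    exact hM (mul_mem_mul hx mem_top)
  have htop := (J.add_mem_iff_right hlow).mp hsum
  have hconst : ∑ j ∈ Finset.range (n + 1), y ^ j * x ^ (n - n) * y ^ (n - j) =
      ((n + 1 : ℕ) : K) • y ^ n := by
    rw [Finset.sum_congr rfl (g := fun _ => y ^ n), Finset.sum_const, Finset.card_range,
      Nat.cast_smul_eq_nsmul]
    intro j hj
    rw [Finset.mem_range] at hj
    rw [Nat.sub_self, pow_zero, mul_one, ← pow_add]
    congr 1
    omega
  rw [hconst, mul_smul_comm] at htop
  exact (J.smul_mem_iff (Nat.cast_ne_zero.mpr n.succ_ne_zero)).mp htop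

/-- Nagata–Higman relative to a two-sided ideal `J`, for a two-sided ideal `M`. -/
theorem Submodule.pow_le_of_forall_pow_mem {M : Submodule K A} (hMl : ⊤ * M ≤ M)
    (hMr : M * ⊤ ≤ M) (n : ℕ) (J : Submodule K A) (hJl : ⊤ * J ≤ J) (hJr : J * ⊤ ≤ J)
    (h : ∀ x ∈ M, x ^ n ∈ J) : M ^ (2 ^ n - 1) ≤ J := by
  induction n generalizing J with
  | zero =>
    rw [pow_zero, Nat.sub_self, pow_zero, one_le]
    simpa using h 0 M.zero_mem
  | succ n ih =>
    let P : Submodule K A := span K ((· ^ n) '' (M : Set A))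
    have hP : P * M * P ≤ J := by
      rw [← span_eq M, span_mul_span, span_mul_span, span_le]
      rintro _ ⟨_, ⟨_, ⟨x, hx, rfl⟩, z, hz, rfl⟩, _, ⟨y, hy, rfl⟩, rfl⟩
      exact pow_mul_mul_pow_mem hMr hJl hJr h hx hy hz
    let I : Submodule K A := J ⊔ ⊤ * P * ⊤
    have hI : M ^ (2 ^ n - 1) ≤ I := by
      refine ih I ?_ ?_ fun x hx => mem_sup_right ?_
      · rw [mul_sup, ← mul_assoc, ← mul_assoc]
        exact sup_le_sup hJl (by gcongr; exact le_top)
      · rw [sup_mul, mul_assoc (⊤ * P)]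
        exact sup_le_sup hJr (by gcongr; exact le_top)
      · rw [← one_mul (x ^ n), ← mul_one (1 * x ^ n)]
        exact mul_mem_mul (mul_mem_mul mem_top (subset_span ⟨x, hx, rfl⟩)) mem_top
    have hexp : 2 ^ (n + 1) - 1 = (2 ^ n - 1) + 1 + (2 ^ n - 1) := by
      have := Nat.one_le_two_pow (n := n)
      omega
    have hl (Q : Submodule K A) : Q * J ≤ J := (mul_le_mul_left le_top J).trans hJl
    have hr (Q : Submodule K A) : J * Q ≤ J := (mul_le_mul_right le_top J).trans hJr
    calc M ^ (2 ^ (n + 1) - 1) = M ^ (2 ^ n - 1) * M * M ^ (2 ^ n - 1) := by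
          rw [hexp, pow_add, pow_succ]
      _ ≤ I * M * I := by gcongr
      _ ≤ J := by
        simp only [I, sup_mul, mul_sup]
        refine sup_le (sup_le ?_ ?_) (sup_le ?_ ?_)
        · exact hl _
        · exact hl _
        · rw [mul_assoc]; exact hr _
        · calc ⊤ * P * ⊤ * M * (⊤ * P * ⊤) = ⊤ * (P * (⊤ * M * ⊤) * P) * ⊤ := by
                simp only [mul_assoc]
            _ ≤ ⊤ * (P * M * P) * ⊤ := by
                gcongr
                exact (mul_le_mul_left hMl ⊤).trans hMr
            _ ≤ J := (mul_le_mul_left ((mul_le_mul_right hP ⊤).trans hJl) ⊤).trans hJr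

end NagataHigman

theorem Unitization.inr_foldl_mul {K R : Type*} [Field K] [NonUnitalRing R] [Module K R]
    [SMulCommClass K R R] [IsScalarTower K R R] (a : R) (l : List R) :
    ((l.foldl (· * ·) a : R) : Unitization K R) =
      ((a :: l).map fun r : R => (r : Unitization K R)).prod := by
  induction l generalizing a with
  | nil => simp
  | cons b l ih => simp [ih, mul_assoc]

/-- **Dubnov–Ivanov–Nagata–Higman.** For every positive integer `k` there is a positive
integer `d = d(k)`, depending only on `k`, such that every (not necessarily unital)
associative algebra over a field of characteristic `0` satisfying the identity `x^k = 0`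
is nilpotent of class `d`: every product of `d` elements is zero.  (Here the `k`-th power of
`r` is written as the left-normed product `r ⋯ r` of `k` copies of `r`, and a product of `d`
elements `a, l 1, …, l (d-1)` as a left-normed fold.) -/
theorem nagata_higman (k : ℕ) (hk : 0 < k) :
    ∃ d : ℕ, 0 < d ∧
      ∀ (K : Type u) (R : Type v) [Field K] [CharZero K] [NonUnitalRing R]
        [Module K R] [SMulCommClass K R R] [IsScalarTower K R R],
        (∀ r : R, (List.replicate (k - 1) r).foldl (· * ·) r = 0) →
        ∀ (a : R) (l : List R), l.length + 1 = d → l.foldl (· * ·) a = 0 := by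
  refine ⟨2 ^ k - 1, by have := Nat.one_lt_two_pow hk.ne'; omega, ?_⟩
  intro K R _ _ _ _ _ _ hR a l hl
  let M : Submodule K (Unitization K R) := LinearMap.range (Unitization.inrHom K K R)
  have hmem (r : R) : (r : Unitization K R) ∈ M := ⟨r, rfl⟩
  have hker (x : Unitization K R) (hx : x.fst = 0) : x ∈ M := ⟨x.snd, by ext <;> simp [hx]⟩
  have hfst (x : Unitization K R) (hx : x ∈ M) : x.fst = 0 := by
    obtain ⟨r, rfl⟩ := hx
    simp
  have hpow : M ^ (2 ^ k - 1) ≤ ⊥ := by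
    refine Submodule.pow_le_of_forall_pow_mem ?_ ?_ k ⊥ (by simp) (by simp) ?_
    · exact Submodule.mul_le.mpr fun x _ y hy => hker _ (by simp [hfst y hy])
    · exact Submodule.mul_le.mpr fun x hx y _ => hker _ (by simp [hfst x hx])
    · rintro _ ⟨r, rfl⟩
      have hr := Unitization.inr_foldl_mul (K := K) r (List.replicate (k - 1) r)
      rw [hR, ← List.replicate_succ, Nat.sub_add_cancel hk, List.map_replicate,
        List.prod_replicate, Unitization.inr_zero] at hr
      exact hr.symm
  have hprod (l : List R) : (l.map fun r : R => (r : Unitization K R)).prod ∈ M ^ l.length := by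
    induction l with
    | nil => exact Submodule.one_le.mp le_rfl
    | cons b l ih =>
      rw [List.map_cons, List.prod_cons, List.length_cons, pow_succ']
      exact Submodule.mul_mem_mul (hmem b) ih
  have hzero := hprod (a :: l)
  rw [List.length_cons, hl, ← Unitization.inr_foldl_mul] at hzero
  exact Unitization.inr_injective (R := K) ((hpow hzero).trans (Unitization.inr_zero K).symm)
end

section
/- (First Fundamental Theorem of Matrix Invariants) Let GL_k(K) act on Ω = K[x_{pq}^{(i)} : 1 ≤ p,q ≤ k, 1 ≤ i ≤ m] by simultaneous conjugation of the generic matrices: g ∈ GL_k(K) induces the algebra automorphism of Ω sending x_{pq}^{(i)} to the (p,q)-entry of g x_i g^{-1}. Then the algebra Ω^{GL_k(K)} of invariant polynomials equals C_{km}, the subalgebra of Ω generated by the traces tr(x_{i_1} x_{i_2} ⋯ x_{i_n}) of all products of generic matrices (n ≥ 1, 1 ≤ i_j ≤ m). -/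
open Matrix

variable (K : Type*) [Field K] [IsAlgClosed K] [CharZero K]

/-- The `i`-th generic `k × k` matrix: the matrix over the polynomial algebra
`Ω = K[x_{pq}^{(i)}]` whose `(p,q)`-entry is the variable `x_{pq}^{(i)}`. -/
noncomputable def genericMatrix (k m : ℕ) (i : Fin m) :
    Matrix (Fin k) (Fin k) (MvPolynomial (Fin m × Fin k × Fin k) K) :=
  Matrix.of fun p q => MvPolynomial.X (i, p, q)

/-- The action of `g ∈ GL_k(K)` on `Ω` by simultaneous conjugation of the generic matrices:
the variable `x_{pq}^{(i)}` is sent to the `(p,q)`-entry of `g xᵢ g⁻¹`. -/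
noncomputable def conjAct {k m : ℕ} (g : GL (Fin k) K) :
    MvPolynomial (Fin m × Fin k × Fin k) K →ₐ[K] MvPolynomial (Fin m × Fin k × Fin k) K :=
  MvPolynomial.aeval fun v =>
    ((((g : Matrix (Fin k) (Fin k) K).map (MvPolynomial.C ·) *
        genericMatrix K k m v.1 *
      ((g⁻¹ : GL (Fin k) K) : Matrix (Fin k) (Fin k) K).map (MvPolynomial.C ·) :
        Matrix (Fin k) (Fin k) (MvPolynomial (Fin m × Fin k × Fin k) K)))
      v.2.1 v.2.2)

section WordSums

variable {F L : Type*} {n : ℕ}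

/-- Two words with the same letter content differ by a permutation of positions. -/
theorem exists_perm_of_sum_single_eq {w v : Fin n → L}
    (h : ∑ a, Finsupp.single (w a) 1 = ∑ a, Finsupp.single (v a) 1) :
    ∃ e : Equiv.Perm (Fin n), w ∘ e = v := by
  classical
  have hcard (x : L) : Fintype.card {a // v a = x} = Fintype.card {a // w a = x} := by
    have hx := DFunLike.congr_fun h x
    simp only [Finsupp.finsetSum_apply, Finsupp.single_apply, Finset.sum_boole] at hx
    simpa [Fintype.card_subtype] using hx.symm
  refine ⟨(Equiv.sigmaFiberEquiv v).symm.trans ((Equiv.sigmaCongrRight fun x =>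
    Fintype.equivOfCardEq (hcard x)).trans (Equiv.sigmaFiberEquiv w)), ?_⟩
  funext a
  exact (Fintype.equivOfCardEq (hcard (v a)) ⟨a, rfl⟩).2

variable [Field F]

theorem prod_X_eq_monomial (w : Fin n → L) :
    ∏ a, (MvPolynomial.X (w a) : MvPolynomial L F) =
      MvPolynomial.monomial (∑ a, Finsupp.single (w a) 1) 1 := by
  rw [MvPolynomial.monomial_sum_one]
  rfl

variable [Fintype L]

/-- The homogeneous polynomial obtained from a tensor of coefficients indexed by words. -/
noncomputable def wordSum : ((Fin n → L) → F) →ₗ[F] MvPolynomial L F where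
  toFun c := ∑ w, c w • ∏ a, MvPolynomial.X (w a)
  map_add' c d := by simp [add_smul, Finset.sum_add_distrib]
  map_smul' r c := by simp [Finset.smul_sum, mul_smul]

theorem wordSum_apply (c : (Fin n → L) → F) :
    wordSum c = ∑ w, c w • ∏ a, MvPolynomial.X (w a) := rfl

theorem wordSum_comp_perm (c : (Fin n → L) → F) (e : Equiv.Perm (Fin n)) :
    wordSum (fun w => c (w ∘ e)) = wordSum c := by
  refine Fintype.sum_equiv (e.symm.arrowCongr (Equiv.refl L)) _ _ fun w => ?_
  rw [← Equiv.prod_comp e fun a => (MvPolynomial.X (w a) : MvPolynomial L F)]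
  rfl

/-- A tensor whose polynomial vanishes has zero symmetrization. -/
theorem sum_perm_eq_zero_of_wordSum_eq_zero {c : (Fin n → L) → F} (h : wordSum c = 0)
    (w : Fin n → L) : ∑ e : Equiv.Perm (Fin n), c (w ∘ e) = 0 := by
  classical
  have hcoeff := congrArg (MvPolynomial.coeff (∑ a, Finsupp.single (w a) 1)) h
  simp only [wordSum_apply, prod_X_eq_monomial, MvPolynomial.coeff_sum, MvPolynomial.coeff_smul,
    MvPolynomial.coeff_monomial, MvPolynomial.coeff_zero, smul_eq_mul] at hcoeff
  have hfiber (v : Fin n → L) :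
      (Finset.univ.filter fun e : Equiv.Perm (Fin n) => w ∘ e = v).card =
        (if ∑ a, Finsupp.single (v a) 1 = ∑ a, Finsupp.single (w a) 1 then 1 else 0) *
          (Finset.univ.filter fun e : Equiv.Perm (Fin n) => w ∘ e = w).card := by
    split_ifs with hv
    · obtain ⟨t, rfl⟩ := exists_perm_of_sum_single_eq hv.symm
      rw [one_mul]
      refine Finset.card_equiv (Equiv.mulRight t⁻¹) fun e => ?_
      simp only [Finset.mem_filter, Finset.mem_univ, true_and, Equiv.coe_mulRight]
      constructor
      · intro he
        funext a
        simpa using congrFun he (t⁻¹ a)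
      · intro he
        funext a
        simpa using congrFun he (t a)
    · rw [zero_mul, Finset.card_eq_zero, Finset.filter_eq_empty_iff]
      rintro e - rfl
      exact hv (Equiv.sum_comp e fun a => Finsupp.single (w a) 1)
  calc ∑ e : Equiv.Perm (Fin n), c (w ∘ e)
      = ∑ v, ((Finset.univ.filter fun e : Equiv.Perm (Fin n) => w ∘ e = v).card : F) * c v := by
        rw [← Finset.sum_fiberwise Finset.univ (fun e : Equiv.Perm (Fin n) => w ∘ e)]
        refine Finset.sum_congr rfl fun v _ => ?_
        rw [← nsmul_eq_mul]
        exact Finset.sum_eq_card_nsmul fun e he => congrArg c (Finset.mem_filter.1 he).2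
    _ = ((Finset.univ.filter fun e : Equiv.Perm (Fin n) => w ∘ e = w).card : F) *
          ∑ v, c v * (if ∑ a, Finsupp.single (v a) 1 = ∑ a, Finsupp.single (w a) 1
            then 1 else 0) := by
        rw [Finset.mul_sum]
        refine Finset.sum_congr rfl fun v _ => ?_
        rw [hfiber v]
        push_cast
        ring
    _ = 0 := by rw [hcoeff, mul_zero]

/-- A symmetric tensor is determined by its polynomial. -/
theorem eq_zero_of_wordSum_eq_zero [CharZero F] {c : (Fin n → L) → F}
    (hc : ∀ (e : Equiv.Perm (Fin n)) w, c (w ∘ e) = c w) (h : wordSum c = 0) : c = 0 := by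
  funext w
  have := sum_perm_eq_zero_of_wordSum_eq_zero h w
  simp only [hc, Finset.sum_const, nsmul_eq_mul, mul_eq_zero, Nat.cast_eq_zero,
    Finset.card_eq_zero, Finset.univ_eq_empty_iff, not_isEmpty_of_nonempty, false_or] at this
  exact this

/-- Every homogeneous polynomial comes from a symmetric tensor. -/
theorem exists_symmetric_wordSum_eq [CharZero F] {f : MvPolynomial L F} (hf : f.IsHomogeneous n) :
    ∃ c : (Fin n → L) → F, (∀ (e : Equiv.Perm (Fin n)) w, c (w ∘ e) = c w) ∧ wordSum c = f := by
  classical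
  have hmono (d : L →₀ ℕ) (hd : d.degree = n) (r : F) :
      MvPolynomial.monomial d r ∈ LinearMap.range (wordSum (F := F) (L := L) (n := n)) := by
    have hlen : d.toMultiset.toList.length = n := by
      rw [Multiset.length_toList, Finsupp.card_toMultiset, ← hd]
      rfl
    subst hlen
    refine ⟨Pi.single (fun a => d.toMultiset.toList[a]) r, ?_⟩
    have hsum : ∑ a : Fin d.toMultiset.toList.length,
        Finsupp.single (d.toMultiset.toList[a]) 1 = d := by
      apply Multiset.toFinsupp.symm.injective
      change Finsupp.toMultiset _ = Finsupp.toMultiset _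
      rw [map_sum]
      simp only [Finsupp.toMultiset_single, one_smul]
      conv_rhs => rw [← Multiset.coe_toList d.toMultiset]
      rw [← List.sum_ofFn]
      have : ∀ l : List L, (List.ofFn fun a : Fin l.length => ({l[a]} : Multiset L)).sum = l := by
        intro l
        induction l with
        | nil => simp
        | cons x l ih => simpa [List.ofFn_succ] using congrArg (x ::ₘ ·) ih
      exact this _
    rw [wordSum_apply, Finset.sum_eq_single (fun a => d.toMultiset.toList[a])
      (fun w _ hw => by rw [Pi.single_eq_of_ne hw, zero_smul]) (by simp), Pi.single_eq_same,
      prod_X_eq_monomial, hsum, MvPolynomial.smul_monomial, smul_eq_mul, mul_one]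
  obtain ⟨c, rfl⟩ : f ∈ LinearMap.range (wordSum (F := F) (L := L) (n := n)) := by
    rw [← MvPolynomial.support_sum_monomial_coeff f]
    exact Submodule.sum_mem _ fun d hd => hmono d
      (by by_contra h; exact MvPolynomial.mem_support_iff.1 hd (hf.coeff_eq_zero h)) _
  refine ⟨(Fintype.card (Equiv.Perm (Fin n)) : F)⁻¹ •
    ∑ e : Equiv.Perm (Fin n), fun w => c (w ∘ e), fun t w => ?_, ?_⟩
  · simp only [Pi.smul_apply, Finset.sum_apply]
    congr 1
    exact Fintype.sum_equiv (Equiv.mulLeft t) _ _ fun e => rfl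
  · simp [wordSum_comp_perm, map_sum, Nat.factorial_ne_zero, Fintype.card_perm,
      ← Nat.cast_smul_eq_nsmul F, smul_smul]

end WordSums

section TensorPower

variable {F ι : Type*} {n : ℕ}

/-- Contracting the indices of a family of square matrices along a permutation gives an element of
any subring containing the traces of all products of the matrices involved. -/
theorem sum_prod_perm_mem [Fintype ι] {R S : Type*} [CommRing R] [SetLike S R]
    [SubringClass S R] (A : S) (P : Set (Matrix ι ι R)) (hmul : ∀ M ∈ P, ∀ N ∈ P, M * N ∈ P)
    (htrace : ∀ M ∈ P, M.trace ∈ A) (M : Fin n → Matrix ι ι R) (hM : ∀ a, M a ∈ P)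
    (e : Equiv.Perm (Fin n)) : ∑ I : Fin n → ι, ∏ a, M a (I a) (I (e a)) ∈ A := by
  induction n with
  | zero => simp [one_mem A]
  | succ n ih =>
    obtain ⟨⟨p, t⟩, rfl⟩ := Equiv.Perm.decomposeFin.symm.surjective e
    rw [← (Fin.consEquiv fun _ => ι).sum_comp, Fintype.sum_prod_type]
    simp only [Fin.consEquiv_apply, Fin.prod_univ_succ, Fin.cons_zero, Fin.cons_succ,
      Equiv.Perm.decomposeFin_symm_apply_zero, Equiv.Perm.decomposeFin_symm_apply_succ]
    cases p using Fin.cases with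
    | zero =>
      simp only [Equiv.swap_self, Equiv.refl_apply, Fin.cons_zero, Fin.cons_succ]
      rw [← Fintype.sum_mul_sum]
      exact mul_mem (htrace _ (hM 0)) (ih _ (fun a => hM a.succ) t)
    | succ b =>
      convert ih (Function.update (fun a => M a.succ) (t.symm b) (M (t.symm b).succ * M 0))
        (fun a => ?_) t using 1
      · rw [Finset.sum_comm]
        refine Finset.sum_congr rfl fun I _ => ?_
        rw [← Finset.mul_prod_erase _ _ (Finset.mem_univ (t.symm b)), Function.update_self,
          Equiv.apply_symm_apply, Matrix.mul_apply, Finset.sum_mul]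
        refine Finset.sum_congr rfl fun j _ => ?_
        rw [← Finset.mul_prod_erase _ _ (Finset.mem_univ (t.symm b)), Equiv.apply_symm_apply,
          Equiv.swap_apply_right, Fin.cons_zero, Fin.cons_succ, ← mul_assoc,
          mul_comm (M 0 _ _)]
        congr 1
        refine Finset.prod_congr rfl fun a ha => ?_
        have hab : a ≠ t.symm b := Finset.ne_of_mem_erase ha
        rw [Function.update_of_ne hab, Equiv.swap_apply_of_ne_of_ne (Fin.succ_ne_zero _)
          (fun h => hab ((Equiv.eq_symm_apply t).2 (Fin.succ_injective _ h))), Fin.cons_succ]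
      · by_cases hab : a = t.symm b
        · subst hab
          rw [Function.update_self]
          exact hmul _ (hM _) _ (hM _)
        · rw [Function.update_of_ne hab]
          exact hM _

variable [Field F]

/-- The matrix of the `n`-th tensor power of a matrix, indexed by words. -/
def tensorPow (n : ℕ) (g : Matrix ι ι F) : Matrix (Fin n → ι) (Fin n → ι) F :=
  Matrix.of fun I J => ∏ a, g (I a) (J a)

theorem tensorPow_apply (g : Matrix ι ι F) (I J : Fin n → ι) :
    tensorPow n g I J = ∏ a, g (I a) (J a) := rfl

theorem tensorPow_mul [Fintype ι] (g h : Matrix ι ι F) :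
    tensorPow n (g * h) = tensorPow n g * tensorPow n h := by
  ext I J
  simp only [Matrix.mul_apply, tensorPow_apply, Finset.prod_univ_sum, Fintype.piFinset_univ,
    Finset.prod_mul_distrib]

variable [DecidableEq ι]

theorem tensorPow_one : tensorPow n (1 : Matrix ι ι F) = 1 := by
  ext I J
  simp [tensorPow_apply, Matrix.one_apply, Finset.prod_ite_zero, funext_iff]

/-- The matrix permuting the tensor factors. -/
def permTensor (F ι : Type*) [Field F] [DecidableEq ι] {n : ℕ} (e : Equiv.Perm (Fin n)) :
    Matrix (Fin n → ι) (Fin n → ι) F :=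
  (1 : Matrix (Fin n → ι) (Fin n → ι) F).submatrix (fun I => I ∘ e) id

theorem permTensor_one : permTensor F ι (1 : Equiv.Perm (Fin n)) = 1 := rfl

variable [Fintype ι]

theorem permTensor_mul_apply (e : Equiv.Perm (Fin n)) (T : Matrix (Fin n → ι) (Fin n → ι) F)
    (I J : Fin n → ι) : (permTensor F ι e * T) I J = T (I ∘ e) J := by
  simp [permTensor, Matrix.mul_apply, Matrix.one_apply]

theorem permTensor_mul (e t : Equiv.Perm (Fin n)) :
    permTensor F ι (e * t) = permTensor F ι e * permTensor F ι t := by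
  ext I J
  rw [permTensor_mul_apply]
  rfl

/-- A polynomial in the entries of a matrix vanishing on the general linear group is zero. -/
theorem eq_zero_of_forall_eval_GL [Infinite F] {f : MvPolynomial (ι × ι) F}
    (h : ∀ g : GL ι F, MvPolynomial.eval (fun v => (g : Matrix ι ι F) v.1 v.2) f = 0) : f = 0 := by
  have hprod : f * (Matrix.mvPolynomialX ι ι F).det = 0 := by
    refine MvPolynomial.funext fun x => ?_
    rw [map_mul, map_zero, mul_eq_zero, or_iff_not_imp_right]
    intro hdet
    have hx : (MvPolynomial.eval x).mapMatrix (Matrix.mvPolynomialX ι ι F) =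
        Matrix.of fun i j => x (i, j) := by
      ext i j
      simp [Matrix.mvPolynomialX]
    rw [RingHom.map_det, hx] at hdet
    exact h (Matrix.GeneralLinearGroup.mkOfDetNeZero _ hdet)
  exact (mul_eq_zero.1 hprod).resolve_right (Matrix.det_mvPolynomialX_ne_zero ι F)

/-- A linear functional vanishing on tensor powers of invertible matrices vanishes on all
matrices that are invariant under simultaneous permutation of the tensor factors. -/
theorem map_eq_zero_of_tensorPow [CharZero F] (φ : Matrix (Fin n → ι) (Fin n → ι) F →ₗ[F] F)
    (hφ : ∀ g : GL ι F, φ (tensorPow n (g : Matrix ι ι F)) = 0)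
    {T : Matrix (Fin n → ι) (Fin n → ι) F}
    (hT : ∀ (e : Equiv.Perm (Fin n)) I J, T (I ∘ e) (J ∘ e) = T I J) : φ T = 0 := by
  let d : (Fin n → ι × ι) → F := fun w =>
    φ (Matrix.single (fun a => (w a).1) (fun a => (w a).2) 1)
  have hexpand (S : Matrix (Fin n → ι) (Fin n → ι) F) :
      φ S = ∑ w : Fin n → ι × ι, d w * S (fun a => (w a).1) (fun a => (w a).2) := by
    conv_lhs => rw [Matrix.matrix_eq_sum_single S]
    rw [← Fintype.sum_prod_type', map_sum]
    refine Fintype.sum_equiv (Equiv.arrowProdEquivProdArrow _ _ _).symm _ _ fun w => ?_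
    have hs : Matrix.single w.1 w.2 (S w.1 w.2) = S w.1 w.2 • Matrix.single w.1 w.2 (1 : F) := by
      rw [Matrix.smul_single, smul_eq_mul, mul_one]
    rw [hs, map_smul, smul_eq_mul, mul_comm]
    rfl
  have hd : wordSum d = 0 := by
    refine eq_zero_of_forall_eval_GL fun g => ?_
    rw [← hφ g, hexpand]
    simp [wordSum_apply, tensorPow_apply, MvPolynomial.smul_eval]
  have hsum : (Fintype.card (Equiv.Perm (Fin n)) : F) * φ T = 0 := by
    calc (Fintype.card (Equiv.Perm (Fin n)) : F) * φ T
        = ∑ e : Equiv.Perm (Fin n), φ T := by simp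
      _ = ∑ e : Equiv.Perm (Fin n), ∑ w : Fin n → ι × ι,
            d (w ∘ e) * T (fun a => (w a).1) (fun a => (w a).2) := by
          refine Finset.sum_congr rfl fun e _ => ?_
          rw [hexpand]
          refine (Fintype.sum_equiv (e.symm.arrowCongr (Equiv.refl _)) _ _ fun w => ?_).symm
          rw [← hT e]
          rfl
      _ = 0 := by
          rw [Finset.sum_comm]
          refine Finset.sum_eq_zero fun w _ => ?_
          rw [← Finset.sum_mul, sum_perm_eq_zero_of_wordSum_eq_zero hd, zero_mul]
  exact (mul_eq_zero.1 hsum).resolve_left (Nat.cast_ne_zero.2 Fintype.card_ne_zero)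

/-- A matrix commuting with all tensor powers of invertible matrices commutes with every
matrix that is invariant under simultaneous permutation of the tensor factors. -/
theorem commute_of_commute_tensorPow [CharZero F] {B T : Matrix (Fin n → ι) (Fin n → ι) F}
    (hB : ∀ g : GL ι F, Commute B (tensorPow n (g : Matrix ι ι F)))
    (hT : ∀ (e : Equiv.Perm (Fin n)) I J, T (I ∘ e) (J ∘ e) = T I J) : Commute B T := by
  rw [commute_iff_eq, ← sub_eq_zero]
  ext I J
  let φ : Matrix (Fin n → ι) (Fin n → ι) F →ₗ[F] F :=
    Matrix.entryLinearMap F F I J ∘ₗ (LinearMap.mulLeft F B - LinearMap.mulRight F B)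
  refine map_eq_zero_of_tensorPow φ (fun g => ?_) hT
  simp [φ, (hB g).eq]

/-- A linear map commuting with left multiplication by permutations of the tensor factors commutes
with left multiplication by any matrix centralizing the tensor powers of invertible matrices. -/
theorem map_mul_of_commute_tensorPow [CharZero F] {B : Matrix (Fin n → ι) (Fin n → ι) F}
    (hB : ∀ g : GL ι F, Commute B (tensorPow n (g : Matrix ι ι F)))
    {q : Matrix (Fin n → ι) (Fin n → ι) F →ₗ[F] Matrix (Fin n → ι) (Fin n → ι) F}
    (hq : ∀ (e : Equiv.Perm (Fin n)) X, q (permTensor F ι e * X) = permTensor F ι e * q X)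
    (X : Matrix (Fin n → ι) (Fin n → ι) F) : q (B * X) = B * q X := by
  let T (J J' : Fin n → ι) : Matrix (Fin n → ι) (Fin n → ι) F :=
    Matrix.of fun I I' => q (Matrix.single I' J' 1) I J
  have hT (J J' : Fin n → ι) : Commute B (T J J') := by
    refine commute_of_commute_tensorPow hB fun e I I' => ?_
    have hsingle : permTensor F ι e * Matrix.single (I' ∘ e) J' (1 : F) =
        Matrix.single I' J' 1 := by
      ext H H'
      simp only [permTensor_mul_apply, Matrix.single_apply,
        e.surjective.injective_comp_right.eq_iff]
    calc q (Matrix.single (I' ∘ e) J' 1) (I ∘ e) J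
        = (permTensor F ι e * q (Matrix.single (I' ∘ e) J' 1)) I J :=
          (permTensor_mul_apply _ _ _ _).symm
      _ = q (Matrix.single I' J' 1) I J := by rw [← hq, hsingle]
  have hexpand (Y : Matrix (Fin n → ι) (Fin n → ι) F) (I J) :
      q Y I J = ∑ J', (T J J' * Y) I J' := by
    conv_lhs => rw [Matrix.matrix_eq_sum_single Y]
    have hs (I' J') : Matrix.single I' J' (Y I' J') = Y I' J' • Matrix.single I' J' (1 : F) := by
      rw [Matrix.smul_single, smul_eq_mul, mul_one]
    rw [Finset.sum_comm]
    simp only [map_sum, hs, map_smul, Matrix.sum_apply, Matrix.smul_apply, Matrix.mul_apply, T,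
      Matrix.of_apply, smul_eq_mul, mul_comm]
  ext I J
  simp only [hexpand, ← Matrix.mul_assoc, ← (hT _ _).eq]
  rw [Matrix.mul_apply]
  simp only [hexpand, Matrix.mul_assoc, Finset.mul_sum]
  rw [Finset.sum_comm]
  exact Finset.sum_congr rfl fun J' _ => Matrix.mul_apply

/-- Schur–Weyl duality: a matrix commuting with all tensor powers of invertible matrices is a
linear combination of permutations of the tensor factors. -/
theorem mem_span_permTensor [CharZero F] {B : Matrix (Fin n → ι) (Fin n → ι) F}
    (hB : ∀ g : GL ι F, Commute B (tensorPow n (g : Matrix ι ι F))) :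
    B ∈ Submodule.span F (Set.range (permTensor F ι (n := n))) := by
  set A := Submodule.span F (Set.range (permTensor F ι (n := n))) with hA
  have hmul (e : Equiv.Perm (Fin n)) {X} (hX : X ∈ A) : permTensor F ι e * X ∈ A := by
    have hle : A ≤ A.comap (LinearMap.mulLeft F (permTensor F ι e)) := by
      rw [hA, Submodule.span_le]
      rintro _ ⟨t, rfl⟩
      exact Submodule.subset_span ⟨e * t, permTensor_mul e t⟩
    exact hle hX
  have hone : (1 : Matrix (Fin n → ι) (Fin n → ι) F) ∈ A :=
    Submodule.subset_span ⟨1, permTensor_one⟩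
  obtain ⟨p, hp⟩ := A.subtype.exists_leftInverse_of_injective A.ker_subtype
  let q : Matrix (Fin n → ι) (Fin n → ι) F →ₗ[F] Matrix (Fin n → ι) (Fin n → ι) F :=
    ∑ e : Equiv.Perm (Fin n), LinearMap.mulLeft F (permTensor F ι e⁻¹) ∘ₗ A.subtype ∘ₗ p ∘ₗ
      LinearMap.mulLeft F (permTensor F ι e)
  have hq_apply (X) : q X = ∑ e : Equiv.Perm (Fin n),
      permTensor F ι e⁻¹ * (p (permTensor F ι e * X) : Matrix (Fin n → ι) (Fin n → ι) F) := by
    simp [q]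
  have hq_mem (X) : q X ∈ A := by
    rw [hq_apply]
    exact Submodule.sum_mem _ fun e _ => hmul _ (p _).2
  have hq_one : q 1 = (Fintype.card (Equiv.Perm (Fin n)) : F) • 1 := by
    rw [hq_apply]
    have hterm (e : Equiv.Perm (Fin n)) : permTensor F ι e⁻¹ *
        (p (permTensor F ι e * 1) : Matrix (Fin n → ι) (Fin n → ι) F) = 1 := by
      have h := LinearMap.congr_fun hp ⟨_, hmul e hone⟩
      simp only [LinearMap.comp_apply, Submodule.subtype_apply, LinearMap.id_apply] at h
      rw [h]
      change permTensor F ι e⁻¹ * (permTensor F ι e * 1) = 1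
      rw [mul_one, ← permTensor_mul, inv_mul_cancel, permTensor_one]
    rw [Finset.sum_congr rfl fun e _ => hterm e, Finset.sum_const, Finset.card_univ,
      Nat.cast_smul_eq_nsmul]
  have hq_perm (t : Equiv.Perm (Fin n)) (X) :
      q (permTensor F ι t * X) = permTensor F ι t * q X := by
    rw [hq_apply, hq_apply, Finset.mul_sum]
    refine Fintype.sum_equiv (Equiv.mulRight t) _ _ fun e => ?_
    rw [Equiv.coe_mulRight, ← mul_assoc, ← mul_assoc, ← permTensor_mul, ← permTensor_mul,
      _root_.mul_inv_rev, mul_inv_cancel_left]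
  have hq_B := map_mul_of_commute_tensorPow hB hq_perm
  have hcard : (Fintype.card (Equiv.Perm (Fin n)) : F) ≠ 0 :=
    Nat.cast_ne_zero.2 Fintype.card_ne_zero
  have hmem := hq_mem B
  rw [← mul_one B, hq_B 1, hq_one, mul_smul_comm, mul_one] at hmem
  exact (A.smul_mem_iff hcard).1 hmem

end TensorPower

section ConjugationInvariants

/-- A linear substitution of the variables acts on word sums through a tensor power. -/
theorem aeval_wordSum {F L : Type*} [Field F] [Fintype L] {n : ℕ} (G : Matrix L L F)
    (c : (Fin n → L) → F) :
    MvPolynomial.aeval (fun v => ∑ u, G v u • (MvPolynomial.X u : MvPolynomial L F)) (wordSum c) =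
      wordSum (c ᵥ* tensorPow n G) := by
  simp only [wordSum_apply, map_sum, map_smul, map_prod, MvPolynomial.aeval_X,
    Finset.prod_univ_sum, Fintype.piFinset_univ, Finset.prod_smul, Matrix.vecMul, dotProduct,
    Finset.smul_sum, Finset.sum_smul, smul_smul, tensorPow_apply]
  exact Finset.sum_comm

/-- The word of matrix entry variables with given generic matrices, rows and columns. -/
def entryWord {k m n : ℕ} (i : Fin n → Fin m) (I J : Fin n → Fin k) :
    Fin n → Fin m × Fin k × Fin k := fun a => (i a, I a, J a)

theorem sum_entryWord {M : Type*} [AddCommMonoid M] {k m n : ℕ}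
    (h : (Fin n → Fin m × Fin k × Fin k) → M) :
    ∑ w, h w = ∑ i, ∑ I, ∑ J, h (entryWord i I J) := by
  simp only [← Fintype.sum_prod_type']
  exact Fintype.sum_equiv ((Equiv.arrowProdEquivProdArrow _ _ _).trans
    ((Equiv.refl _).prodCongr (Equiv.arrowProdEquivProdArrow _ _ _))) _ _ fun w => rfl

variable {F : Type*} [Field F] {k m n : ℕ}

/-- The matrix of the conjugation action on the matrix entry variables. -/
def conjMatrix (m : ℕ) (g : GL (Fin k) F) :
    Matrix (Fin m × Fin k × Fin k) (Fin m × Fin k × Fin k) F :=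
  Matrix.of fun v u => if v.1 = u.1 then
    (g : Matrix (Fin k) (Fin k) F) v.2.1 u.2.1 *
      ((g⁻¹ : GL (Fin k) F) : Matrix (Fin k) (Fin k) F) u.2.2 v.2.2 else 0

theorem tensorPow_conjMatrix_apply (g : GL (Fin k) F) (i i' : Fin n → Fin m)
    (I J I' J' : Fin n → Fin k) :
    tensorPow n (conjMatrix m g) (entryWord i I J) (entryWord i' I' J') =
      if i = i' then tensorPow n (g : Matrix (Fin k) (Fin k) F) I I' *
        tensorPow n ((g⁻¹ : GL (Fin k) F) : Matrix (Fin k) (Fin k) F) J' J else 0 := by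
  simp [tensorPow_apply, conjMatrix, entryWord, Finset.prod_ite_zero, Finset.prod_mul_distrib,
    funext_iff]

theorem commute_tensorPow_of_vecMul_eq {c : (Fin n → Fin m × Fin k × Fin k) → F}
    {g : GL (Fin k) F} (hc : c ᵥ* tensorPow n (conjMatrix m g) = c) (i : Fin n → Fin m) :
    Commute (Matrix.of fun J I => c (entryWord i I J))
      (tensorPow n (g : Matrix (Fin k) (Fin k) F)) := by
  set B : Matrix (Fin n → Fin k) (Fin n → Fin k) F := Matrix.of fun J I => c (entryWord i I J)
  have hB : tensorPow n ((g⁻¹ : GL (Fin k) F) : Matrix (Fin k) (Fin k) F) *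
      (B * tensorPow n (g : Matrix (Fin k) (Fin k) F)) = B := by
    ext J' I'
    have h := congrFun hc (entryWord i I' J')
    simp only [Matrix.vecMul, dotProduct, sum_entryWord, tensorPow_conjMatrix_apply] at h
    rw [Finset.sum_eq_single i (fun i' _ hi => by simp [hi]) (by simp)] at h
    simp only [if_true] at h
    rw [Finset.sum_comm] at h
    simp only [Matrix.mul_apply, Finset.mul_sum]
    rw [show B J' I' = c (entryWord i I' J') from rfl, ← h]
    refine Finset.sum_congr rfl fun J _ => Finset.sum_congr rfl fun I _ => ?_
    simp only [B, Matrix.of_apply]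
    ring
  rw [commute_iff_eq]
  conv_rhs => rw [← hB]
  rw [← Matrix.mul_assoc, ← tensorPow_mul, ← Units.val_mul, mul_inv_cancel, Units.val_one,
    tensorPow_one, Matrix.one_mul]

theorem conjAct_eq_aeval (g : GL (Fin k) F) :
    conjAct F (m := m) g = MvPolynomial.aeval fun v => ∑ u, conjMatrix m g v u •
      (MvPolynomial.X u : MvPolynomial (Fin m × Fin k × Fin k) F) := by
  refine MvPolynomial.algHom_ext fun v => ?_
  simp only [conjAct, MvPolynomial.aeval_X, Matrix.mul_apply, Matrix.map_apply, Finset.sum_mul,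
    genericMatrix, Matrix.of_apply, Fintype.sum_prod_type, conjMatrix, ite_smul, zero_smul]
  rw [Finset.sum_eq_single v.1 (fun i _ hi => by simp [hi.symm]) (by simp), Finset.sum_comm]
  simp only [if_true, MvPolynomial.smul_eq_C_mul, MvPolynomial.C_mul]
  refine Finset.sum_congr rfl fun p _ => Finset.sum_congr rfl fun q _ => ?_
  ring

theorem conjAct_trace_prod (g : GL (Fin k) F) (l : List (Fin m)) :
    conjAct F g (Matrix.trace (l.map (genericMatrix F k m)).prod) =
      Matrix.trace (l.map (genericMatrix F k m)).prod := by
  set G := (g : Matrix (Fin k) (Fin k) F).map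
    (MvPolynomial.C : F →+* MvPolynomial (Fin m × Fin k × Fin k) F) with hG
  set H := ((g⁻¹ : GL (Fin k) F) : Matrix (Fin k) (Fin k) F).map
    (MvPolynomial.C : F →+* MvPolynomial (Fin m × Fin k × Fin k) F) with hH
  have hHG : H * G = 1 := by
    rw [hG, hH, ← Matrix.map_mul, ← Units.val_mul, inv_mul_cancel, Units.val_one,
      Matrix.map_one _ (map_zero _) (map_one _)]
  have hGH : G * H = 1 := mul_eq_one_comm.1 hHG
  have hgen (i : Fin m) : (conjAct F g).mapMatrix (genericMatrix F k m i) =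
      G * genericMatrix F k m i * H := by
    ext p q
    simp only [AlgHom.mapMatrix_apply, Matrix.map_apply, genericMatrix, Matrix.of_apply, conjAct,
      MvPolynomial.aeval_X]
    rfl
  have hprod : (conjAct F g).mapMatrix (l.map (genericMatrix F k m)).prod =
      G * (l.map (genericMatrix F k m)).prod * H := by
    induction l with
    | nil => simp [hGH]
    | cons i l ih =>
      rw [List.map_cons, List.prod_cons, map_mul, ih, hgen]
      calc G * genericMatrix F k m i * H * (G * (l.map (genericMatrix F k m)).prod * H)
          = G * genericMatrix F k m i * (H * G) * ((l.map (genericMatrix F k m)).prod * H) := by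
            simp only [Matrix.mul_assoc]
        _ = G * (genericMatrix F k m i * (l.map (genericMatrix F k m)).prod) * H := by
            rw [hHG]
            simp only [Matrix.mul_assoc, Matrix.mul_one]
  rw [AddMonoidHom.map_trace, ← AlgHom.mapMatrix_apply]
  erw [hprod]
  rw [Matrix.trace_mul_comm, ← Matrix.mul_assoc, hHG, Matrix.one_mul]

theorem homogeneousComponent_conjAct (g : GL (Fin k) F) (n : ℕ)
    (f : MvPolynomial (Fin m × Fin k × Fin k) F) :
    MvPolynomial.homogeneousComponent n (conjAct F g f) =
      conjAct F g (MvPolynomial.homogeneousComponent n f) := by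
  have hhom (d : ℕ) : (conjAct F g (MvPolynomial.homogeneousComponent d f)).IsHomogeneous d := by
    have hlin (v : Fin m × Fin k × Fin k) : (∑ u, conjMatrix m g v u •
        (MvPolynomial.X u : MvPolynomial (Fin m × Fin k × Fin k) F)).IsHomogeneous 1 :=
      MvPolynomial.IsHomogeneous.sum _ _ _ fun u _ => by
        rw [MvPolynomial.smul_eq_C_mul]
        exact MvPolynomial.isHomogeneous_C_mul_X _ _
    have h := (MvPolynomial.homogeneousComponent_isHomogeneous d f).aeval _ hlin
    rwa [one_mul, ← conjAct_eq_aeval] at h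
  conv_lhs => rw [← MvPolynomial.sum_homogeneousComponent f]
  rw [map_sum, map_sum]
  simp only [MvPolynomial.homogeneousComponent_of_mem (hhom _)]
  rw [Finset.sum_ite_eq]
  split_ifs with hn
  · rfl
  · rw [MvPolynomial.homogeneousComponent_eq_zero, map_zero]
    simpa [Nat.lt_succ_iff] using hn

/-- Homogeneous conjugation invariants are polynomials in traces of products. -/
theorem mem_adjoin_trace_of_isHomogeneous [CharZero F]
    {f : MvPolynomial (Fin m × Fin k × Fin k) F} (hf : f.IsHomogeneous n)
    (hinv : ∀ g : GL (Fin k) F, conjAct F g f = f) :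
    f ∈ Algebra.adjoin F
      {x : MvPolynomial (Fin m × Fin k × Fin k) F |
        ∃ l : List (Fin m), l ≠ [] ∧ x = Matrix.trace ((l.map (genericMatrix F k m)).prod)} := by
  set A := Algebra.adjoin F
    {x : MvPolynomial (Fin m × Fin k × Fin k) F |
      ∃ l : List (Fin m), l ≠ [] ∧ x = Matrix.trace ((l.map (genericMatrix F k m)).prod)}
  obtain ⟨c, hsymm, rfl⟩ := exists_symmetric_wordSum_eq hf
  have hc (g : GL (Fin k) F) : c ᵥ* tensorPow n (conjMatrix m g) = c := by
    rw [← sub_eq_zero]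
    refine eq_zero_of_wordSum_eq_zero (fun e w => ?_) ?_
    · simp only [Pi.sub_apply, hsymm]
      congr 1
      simp only [Matrix.vecMul, dotProduct]
      refine (Fintype.sum_equiv (e.symm.arrowCongr (Equiv.refl _)) _ _ fun v => ?_).symm
      rw [← hsymm e v, tensorPow_apply, ← Equiv.prod_comp e]
      rfl
    · rw [map_sub, ← aeval_wordSum, ← conjAct_eq_aeval, hinv, sub_self]
  rw [wordSum_apply, sum_entryWord]
  refine sum_mem fun i _ => ?_
  let Ψ : Matrix (Fin n → Fin k) (Fin n → Fin k) F →ₗ[F]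
      MvPolynomial (Fin m × Fin k × Fin k) F :=
    ∑ I, ∑ J, (Matrix.entryLinearMap F F J I).smulRight
      (∏ a, MvPolynomial.X (entryWord i I J a))
  have hΨ (B) : Ψ B = ∑ I, ∑ J, B J I • ∏ a, MvPolynomial.X (entryWord i I J a) := by
    simp [Ψ]
  have hspan : Submodule.span F (Set.range (permTensor F (Fin k) (n := n))) ≤
      (Subalgebra.toSubmodule A).comap Ψ := by
    rw [Submodule.span_le]
    rintro _ ⟨e, rfl⟩
    change Ψ (permTensor F (Fin k) e) ∈ A
    have hsum : Ψ (permTensor F (Fin k) e) = ∑ J : Fin n → Fin k,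
        ∏ a, genericMatrix F k m (i (e.symm a)) (J a) (J (e.symm a)) := by
      rw [hΨ, Finset.sum_comm]
      refine Finset.sum_congr rfl fun J _ => ?_
      rw [← Equiv.prod_comp e]
      simp [permTensor, Matrix.one_apply, entryWord, genericMatrix]
    rw [hsum]
    refine sum_prod_perm_mem A
      {M | ∃ l : List (Fin m), l ≠ [] ∧ M = (l.map (genericMatrix F k m)).prod} ?_ ?_ _
      (fun a => ⟨[i (e.symm a)], by simp⟩) e.symm
    · rintro _ ⟨l, hl, rfl⟩ _ ⟨l', -, rfl⟩
      exact ⟨l ++ l', by simp [hl], by simp⟩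
    · rintro _ ⟨l, hl, rfl⟩
      exact Algebra.subset_adjoin ⟨l, hl, rfl⟩
  have hmem := hspan (mem_span_permTensor fun g => commute_tensorPow_of_vecMul_eq (hc g) i)
  rw [Submodule.mem_comap, hΨ] at hmem
  exact hmem

end ConjugationInvariants

/-- **First Fundamental Theorem of Matrix Invariants (Gurevich, Procesi, Sibirskii).**
A polynomial in the entries of `m` generic `k × k` matrices is invariant under simultaneous
conjugation by `GL_k(K)` if and only if it lies in the subalgebra `C_{km}` generated by the
traces of all products of the generic matrices. -/
theorem first_fundamental_theorem_matrix_invariants (k m : ℕ)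
    (f : MvPolynomial (Fin m × Fin k × Fin k) K) :
    (∀ g : GL (Fin k) K, conjAct K g f = f) ↔
      f ∈ Algebra.adjoin K
        {x : MvPolynomial (Fin m × Fin k × Fin k) K |
          ∃ l : List (Fin m), l ≠ [] ∧
            x = Matrix.trace ((l.map (genericMatrix K k m)).prod)} := by
  constructor
  · intro h
    rw [← MvPolynomial.sum_homogeneousComponent f]
    refine sum_mem fun n _ => mem_adjoin_trace_of_isHomogeneous
      (MvPolynomial.homogeneousComponent_isHomogeneous n f) fun g => ?_
    rw [← homogeneousComponent_conjAct, h g]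
  · intro hf g
    induction hf using Algebra.adjoin_induction with
    | mem x hx =>
      obtain ⟨l, -, rfl⟩ := hx
      exact conjAct_trace_prod g l
    | algebraMap r => exact (conjAct K g).commutes r
    | add x y _ _ hx hy => rw [map_add, hx, hy]
    | mul x y _ _ hx hy => rw [map_mul, hx, hy]
end

section
/- (Second Fundamental Theorem of Matrix Invariants; Helling–Razmyslov–Procesi) For a permutation σ ∈ S_n with cycle decomposition σ = (i_1 … i_p)⋯(j_1 … j_q) (including 1-cycles, each of 1,…,n occurring exactly once), define the trace function tr_σ : M_k(K)^n → K by tr_σ(a_1,…,a_n) = tr(a_{i_1}⋯a_{i_p})⋯tr(a_{j_1}⋯a_{j_q}). Then for scalars α_σ ∈ K, the multilinear trace identity Σ_{σ∈S_n} α_σ tr_σ(a_1,…,a_n) = 0 holds for all a_1,…,a_n ∈ M_k(K) if and only if the element Σ_{σ∈S_n} α_σ σ of the group algebra KS_n belongs to the two-sided ideal of KS_n generated by Σ_{σ∈S_{k+1}} sign(σ) σ, where S_{k+1} is embedded in S_n as the permutations fixing k+2,…,n (assuming n ≥ k+1). -/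
open Matrix

/-- The trace function associated to a permutation `σ ∈ S_n`: if
`σ = (i_1 … i_p) ⋯ (j_1 … j_q)` is the cycle decomposition (including `1`-cycles), then
`tr_σ(a_1,…,a_n) = tr(a_{i_1} ⋯ a_{i_p}) ⋯ tr(a_{j_1} ⋯ a_{j_q})`; in closed form,
`tr_σ(a) = ∑_{j : Fin n → Fin k} ∏ i, (a i) (j i) (j (σ i))`. -/
noncomputable def permTrace {K : Type*} [CommRing K] {k n : ℕ}
    (σ : Equiv.Perm (Fin n)) (a : Fin n → Matrix (Fin k) (Fin k) K) : K :=
  ∑ j : Fin n → Fin k, ∏ i, a i (j i) (j (σ i))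

section Antisymmetrizer

open Equiv Equiv.Perm Finset

variable {X R : Type*} [Fintype X] [DecidableEq X] [Ring R]

/-- The image under `ρ` of the antisymmetrizer of the permutations fixing every point
outside `S`. -/
def antisymmetrizer (ρ : Perm X →* R) (S : Finset X) : R :=
  ∑ σ : Perm X with ∀ x ∉ S, σ x = x, ((sign σ : ℤ) : R) * ρ σ

theorem antisymmetrizer_empty (ρ : Perm X →* R) : antisymmetrizer ρ ∅ = 1 := by
  have h : (univ.filter fun σ : Perm X => ∀ x ∉ (∅ : Finset X), σ x = x) = {1} := by
    ext σ
    simp [Equiv.ext_iff]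
  rw [antisymmetrizer, h]
  simp

theorem map_antisymmetrizer {R' : Type*} [Ring R'] (φ : R →+* R') (ρ : Perm X →* R)
    (S : Finset X) :
    φ (antisymmetrizer ρ S) = antisymmetrizer ((φ : R →* R').comp ρ) S := by
  simp [antisymmetrizer]

theorem antisymmetrizer_map (ρ : Perm X →* R) (g : Perm X) (S : Finset X) :
    antisymmetrizer ρ (S.map g.toEmbedding) = ρ g * antisymmetrizer ρ S * ρ g⁻¹ := by
  simp only [antisymmetrizer, mul_sum, sum_mul]
  refine (sum_equiv (MulAut.conj g).toEquiv ?_ ?_).symm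
  · intro σ
    simp only [mem_filter, mem_univ, true_and, mem_map_equiv]
    constructor
    · intro h x hx
      simp [h _ hx]
    · intro h x hx
      simpa using h (g x) (by simpa using hx)
  · intro σ _
    simp only [MulEquiv.toEquiv_eq_coe, EquivLike.coe_coe, MulAut.conj_apply, map_mul, sign_inv]
    rw [mul_comm (sign g), mul_assoc (sign σ), Int.units_mul_self, mul_one,
      ← mul_assoc (ρ g), ← mul_assoc, ← mul_assoc, (Int.cast_commute _ (ρ g)).eq]

theorem antisymmetrizer_insert (ρ : Perm X →* R) {x : X} {S : Finset X} (hx : x ∉ S) :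
    antisymmetrizer ρ (insert x S) =
      antisymmetrizer ρ S * (1 - ∑ y ∈ S, ρ (swap y x)) := by
  have key : antisymmetrizer ρ (insert x S) =
      ∑ y ∈ insert x S, antisymmetrizer ρ S * (((sign (swap y x) : ℤ) : R) * ρ (swap y x)) := by
    simp only [antisymmetrizer, sum_mul]
    rw [← sum_product']
    refine sum_bij' (fun σ _ => (σ⁻¹ x, σ * swap (σ⁻¹ x) x)) (fun p _ => p.2 * swap p.1 x)
      ?_ ?_ ?_ ?_ ?_
    · intro σ hσ
      simp only [mem_filter, mem_univ, true_and] at hσ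
      simp only [mem_product, mem_filter, mem_univ, true_and]
      constructor
      · by_contra h
        have := hσ _ h
        rw [← Perm.mul_apply, mul_inv_cancel, Perm.one_apply] at this
        exact h (this ▸ mem_insert_self _ _)
      · intro y hy
        by_cases hyx : y = x
        · subst hyx; simp
        · have h1 : σ y = y := hσ y (by simp [hyx, hy])
          have h2 : y ≠ σ⁻¹ x := by
            rintro h
            apply hyx
            rw [← h1, h]; simp
          rw [Perm.mul_apply, swap_apply_of_ne_of_ne h2 hyx, h1]
    · rintro ⟨y, σ⟩ h
      simp only [mem_product, mem_filter, mem_univ, true_and] at h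
      simp only [mem_filter, mem_univ, true_and]
      intro z hz
      have h2 : z ≠ y := fun e => hz (e ▸ h.1)
      have h3 : z ≠ x := fun e => hz (e ▸ mem_insert_self _ _)
      rw [Perm.mul_apply, swap_apply_of_ne_of_ne h2 h3]
      exact h.2 _ fun e => hz (mem_insert_of_mem e)
    · intro σ _
      simp [mul_assoc]
    · rintro ⟨y, σ⟩ h
      simp only [mem_product, mem_filter, mem_univ, true_and] at h
      have : σ⁻¹ x = x := by rw [inv_eq_iff_eq, h.2 x hx]
      have h2 : (σ * swap y x)⁻¹ x = y := by
        rw [_root_.mul_inv_rev, Perm.mul_apply, this, swap_inv, swap_apply_right]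
      simp only [h2, mul_assoc, Equiv.swap_mul_self, mul_one]
    · intro σ _
      have e : σ = σ * swap (σ⁻¹ x) x * swap (σ⁻¹ x) x := by simp [mul_assoc]
      conv_lhs => rw [e]
      generalize σ * swap (σ⁻¹ x) x = τ
      generalize swap (σ⁻¹ x) x = t
      simp only [map_mul, Units.val_mul, Int.cast_mul]
      rw [mul_assoc, mul_assoc, ← mul_assoc (ρ τ), ← (Int.cast_commute _ (ρ τ)).eq, mul_assoc]
  rw [key, ← mul_sum, sum_insert hx]
  congr 1
  rw [sub_eq_add_neg, ← sum_neg_distrib]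
  congr 1
  · rw [swap_self]
    exact (congrArg₂ (· * ·) (by simp) (map_one ρ)).trans (one_mul 1)
  · refine sum_congr rfl fun y hy => ?_
    have : y ≠ x := fun e => hx (e ▸ hy)
    simp [sign_swap this]

end Antisymmetrizer

section Colourings

open Equiv Equiv.Perm Finset

variable {X R : Type*} [Fintype X] [DecidableEq X] [Ring R]

/-- Moving a point `x` into a colour class `c` other than its own: the sum of the images of `v`
under the transpositions of `x` with the points of the enlarged class is invariant under the
stabilizer of the new colouring. -/
theorem invariant_sum_swap {C : Type*} [DecidableEq C] (ρ : Perm X →* R) {f : X → C} {v : R}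
    (hv : ∀ σ : Perm X, f ∘ σ = f → ρ σ * v = v) (x : X) (c : C) (σ : Perm X)
    (hσ : Function.update f x c ∘ σ = Function.update f x c) :
    ρ σ * ∑ b with Function.update f x c b = c, ρ (swap b x) * v =
      ∑ b with Function.update f x c b = c, ρ (swap b x) * v := by
  set f' := Function.update f x c with hf'
  have hσ' : ∀ y, f' (σ y) = f' y := congrFun hσ
  have hx : f' x = c := by simp [hf']
  rw [mul_sum]
  refine sum_equiv σ (by simp [hσ']) fun b hb => ?_
  simp only [mem_filter, mem_univ, true_and] at hb
  have hsw : ∀ b, f' b = c → ∀ y, f' (swap b x y) = f' y := by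
    intro b hb y
    rw [swap_apply_def]
    split_ifs with h1 h2
    · rw [h1, hb, hx]
    · rw [h2, hb, hx]
    · rfl
  set h : Perm X := swap (σ b) x * σ * swap b x with hh
  have hhx : h x = x := by simp [hh]
  have hfh : f ∘ h = f := by
    funext y
    by_cases hy : y = x
    · rw [Function.comp_apply, hy, hhx]
    · have h1 : h y ≠ x := fun e => hy (h.injective (e.trans hhx.symm))
      have h2 : f' (h y) = f' y := by
        simp only [hh, Perm.mul_apply]
        rw [hsw _ (by rw [hσ', hb]), hσ', hsw _ hb]
      simpa [hf', Function.update_of_ne h1, Function.update_of_ne hy] using h2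
  have hprod : swap (σ b) x * h = σ * swap b x := by
    rw [hh, ← mul_assoc, ← mul_assoc, Equiv.swap_mul_self, one_mul]
  rw [← mul_assoc, ← map_mul, ← hprod, map_mul, mul_assoc, hv h hfh]

/-- The number of ordered pairs of points of the same colour. -/
def colourEnergy {C : Type*} [Fintype C] [DecidableEq C] (f : X → C) : ℕ :=
  ∑ c, #{y | f y = c} ^ 2

theorem colourEnergy_lt_update {C : Type*} [Fintype C] [DecidableEq C] (f : X → C) {x : X} {c : C}
    (hx : f x ≠ c) (hc : #{y | f y = f x} ≤ #{y | f y = c}) :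
    colourEnergy f < colourEnergy (Function.update f x c) := by
  have h1 : #{y | Function.update f x c y = c} = #{y | f y = c} + 1 := by
    rw [← card_insert_of_notMem (s := {y | f y = c}) (a := x) (by simpa using hx)]
    congr 1
    ext y
    by_cases hy : y = x <;> simp [hy, Function.update_of_ne]
  have h2 : #{y | Function.update f x c y = f x} + 1 = #{y | f y = f x} := by
    rw [← card_insert_of_notMem (s := {y | Function.update f x c y = f x}) (a := x)
      (by simpa using hx.symm)]
    congr 1
    ext y
    by_cases hy : y = x <;> simp [hy, Function.update_of_ne]
  have h3 : ∀ d ∈ (univ.erase c).erase (f x),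
      #{y | Function.update f x c y = d} ^ 2 = #{y | f y = d} ^ 2 := by
    intro d hd
    simp only [mem_erase, mem_univ, and_true] at hd
    congr 2
    ext y
    by_cases hy : y = x
    · simp [hy, hd.1.symm, hd.2.symm]
    · simp [Function.update_of_ne hy]
  have hfx : f x ∈ univ.erase c := by simpa using hx
  unfold colourEnergy
  rw [← add_sum_erase _ _ (mem_univ c), ← add_sum_erase _ _ hfx,
    ← add_sum_erase _ _ (mem_univ c), ← add_sum_erase _ _ hfx, sum_congr rfl h3, h1, ← h2]
  nlinarith

/-- If `v` is invariant under the stabilizer of `f` and every transposition sum merging a point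
into a colour class at least as large as its own is `-v`, then `v` vanishes as soon as it is
annihilated by the antisymmetrizers of the transversals of a set `T` of colours. -/
theorem eq_zero_of_antisymmetrizer_transversal {C : Type*} [Fintype C] [DecidableEq C]
    (hR : ∀ m : ℕ, m ≠ 0 → IsUnit (m : R)) (ρ : Perm X →* R) (f : X → C) (v : R)
    (hswap : ∀ x c, f x ≠ c → #{y | f y = f x} ≤ #{y | f y = c} →
      ∑ b with f b = c, ρ (swap x b) * v = -v)
    (T : Finset C) (hT : ∀ c ∈ T, ∃ x, f x = c)
    (h : ∀ S : Finset X, Set.InjOn f S → S.image f = T → antisymmetrizer ρ S * v = 0) :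
    v = 0 := by
  induction T using induction_on_max_value (fun c => #{y | f y = c}) with
  | empty => simpa [antisymmetrizer_empty] using h ∅ (by simp) (by simp)
  | insert a T ha hmax ih =>
    refine ih (fun c hc => hT c (mem_insert_of_mem hc)) fun S hS hST => ?_
    have hxS : ∀ x, f x = a → x ∉ S := by
      rintro x rfl hx
      exact ha (hST ▸ mem_image_of_mem f hx)
    have hzero : ∀ x, f x = a →
        antisymmetrizer ρ S * (v - ∑ y ∈ S, ρ (swap y x) * v) = 0 := by
      intro x hx
      have := h (insert x S) (by
        rw [coe_insert, Set.injOn_insert (by simpa using hxS x hx)]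
        refine ⟨hS, ?_⟩
        rw [hx, ← coe_image, hST]
        simpa using ha) (by rw [image_insert, hx, hST])
      rwa [antisymmetrizer_insert ρ (hxS x hx), mul_assoc, sub_mul, one_mul, sum_mul] at this
    have hsum : ∑ x with f x = a, (v - ∑ y ∈ S, ρ (swap y x) * v) =
        ((#{x | f x = a} + #S : ℕ) : R) * v := by
      have : ∀ y ∈ S, ∑ x with f x = a, ρ (swap y x) * v = -v := by
        intro y hy
        have hyT : f y ∈ T := hST ▸ mem_image_of_mem f hy
        exact hswap y a (fun e => ha (e ▸ hyT)) (hmax _ hyT)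
      rw [sum_sub_distrib, sum_comm, sum_congr rfl this]
      simp [add_mul]
    have hprod : antisymmetrizer ρ S * (((#{x | f x = a} + #S : ℕ) : R) * v) = 0 := by
      rw [← hsum, mul_sum]
      exact sum_eq_zero fun x hx => hzero x (by simpa using hx)
    rw [← mul_assoc, ← (Nat.cast_commute _ _).eq, mul_assoc] at hprod
    refine (hR _ ?_).mul_right_eq_zero.1 hprod
    obtain ⟨x, hx⟩ := hT a (mem_insert_self _ _)
    have : 0 < #{x | f x = a} := card_pos.2 ⟨x, by simpa using hx⟩
    omega

/-- The image under `ρ` of the sum of the stabilizer of the colouring `g`. -/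
def symmetrizer {C : Type*} [DecidableEq C] (ρ : Perm X →* R) (g : X → C) : R :=
  ∑ σ with g ∘ (σ : Perm X) = g, ρ σ

theorem map_symmetrizer {C R' : Type*} [DecidableEq C] [Ring R'] (φ : R →+* R') (ρ : Perm X →* R)
    (g : X → C) : φ (symmetrizer ρ g) = symmetrizer ((φ : R →* R').comp ρ) g := by
  simp [symmetrizer]

theorem symmetrizer_mul {C : Type*} [DecidableEq C] (ρ : Perm X →* R) (g : X → C) (τ : Perm X) :
    symmetrizer ρ g * ρ τ = ρ τ * symmetrizer ρ (g ∘ τ) := by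
  rw [symmetrizer, symmetrizer, sum_mul, mul_sum]
  refine sum_equiv (MulAut.conj τ⁻¹).toEquiv ?_ ?_
  · intro σ
    simp only [mem_filter, mem_univ, true_and, funext_iff, Function.comp_apply]
    constructor
    · intro h x
      simp [h]
    · intro h x
      simpa using h (τ⁻¹ x)
  · intro σ _
    simp [← map_mul, mul_assoc]

theorem symmetrizer_mul_of_invariant {C : Type*} [DecidableEq C] (ρ : Perm X →* R) (g : X → C)
    {v : R} (hv : ∀ σ : Perm X, g ∘ σ = g → ρ σ * v = v) :
    symmetrizer ρ g * v = (#{σ : Perm X | g ∘ σ = g} : R) * v := by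
  rw [symmetrizer, sum_mul, sum_congr rfl fun σ hσ => hv σ (by simpa using hσ)]
  simp

/-- If the antisymmetrizers of all `(k+1)`-element sets vanish in `R`, then so does every element
that is annihilated by the symmetrizers of all `k`-colourings and is invariant under the
stabilizer of some colouring. -/
theorem eq_zero_of_invariant {k : ℕ}
    (hR : ∀ m : ℕ, m ≠ 0 → IsUnit (m : R)) (ρ : Perm X →* R)
    (hanti : ∀ S : Finset X, #S = k + 1 → antisymmetrizer ρ S = 0) (f : X → X) (v : R)
    (hsymm : ∀ g : X → Fin k, symmetrizer ρ g * v = 0)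
    (hv : ∀ σ : Perm X, f ∘ σ = f → ρ σ * v = v) : v = 0 := by
  have hbound : ∀ f : X → X, colourEnergy f ≤ Fintype.card X * Fintype.card X ^ 2 := by
    intro f
    refine (sum_le_card_nsmul univ _ (Fintype.card X ^ 2) fun c _ => ?_).trans (by simp)
    gcongr
    exact card_le_univ _
  induction hN : Fintype.card X * Fintype.card X ^ 2 - colourEnergy f
    using Nat.strong_induction_on generalizing f v with
  | _ N ih =>
  rcases le_or_gt #(univ.image f) k with hk | hk
  · obtain ⟨e⟩ := Function.Embedding.nonempty_of_card_le
      (α := univ.image f) (β := Fin k) (by rwa [Fintype.card_coe, Fintype.card_fin])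
    set g : X → Fin k := fun x => e ⟨f x, mem_image_of_mem f (mem_univ x)⟩ with hg
    have hfg : ∀ σ : Perm X, g ∘ σ = g → f ∘ σ = f := by
      intro σ h
      funext x
      simpa [hg] using congrFun h x
    have h := hsymm g
    rw [symmetrizer_mul_of_invariant ρ g fun σ h => hv σ (hfg σ h)] at h
    refine (hR _ (card_pos.2 ⟨1, ?_⟩).ne').mul_right_eq_zero.1 h
    simp
  · obtain ⟨T, hT, hTcard⟩ := exists_subset_card_eq (Nat.succ_le_of_lt hk)
    refine eq_zero_of_antisymmetrizer_transversal hR ρ f v ?_ T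
      (fun c hc => by simpa using hT hc) fun S hS hST => ?_
    · intro x c hxc hle
      have hlt := colourEnergy_lt_update f hxc hle
      have hle' := hbound (Function.update f x c)
      have h := ih _ (by omega) (Function.update f x c) _ (fun g => ?_)
        (invariant_sum_swap ρ hv x c) rfl
      · have hfilter : univ.filter (fun b => Function.update f x c b = c) =
            insert x (univ.filter fun b => f b = c) := by
          ext y
          by_cases hy : y = x <;> simp [hy, Function.update_of_ne]
        rw [hfilter, sum_insert (by simpa using hxc), swap_self] at h
        simp_rw [swap_comm x]
        rw [eq_neg_iff_add_eq_zero, add_comm, ← h]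
        congr 1
        exact ((congrArg (· * v) (map_one ρ)).trans (one_mul v)).symm
      · rw [mul_sum]
        refine sum_eq_zero fun b _ => ?_
        rw [← mul_assoc, symmetrizer_mul, mul_assoc, hsymm, mul_zero]
    · rw [hanti S (by rw [← card_image_of_injOn hS, hST, hTcard]), zero_mul]

/-- If the antisymmetrizers of all `(k+1)`-element sets vanish in `R`, then so does every element
annihilated by the symmetrizers of all `k`-colourings. -/
theorem eq_zero_of_symmetrizer_mul_eq_zero {k : ℕ}
    (hR : ∀ m : ℕ, m ≠ 0 → IsUnit (m : R)) (ρ : Perm X →* R)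
    (hanti : ∀ S : Finset X, #S = k + 1 → antisymmetrizer ρ S = 0) (v : R)
    (hsymm : ∀ g : X → Fin k, symmetrizer ρ g * v = 0) : v = 0 := by
  refine eq_zero_of_invariant hR ρ hanti id v hsymm fun σ hσ => ?_
  have : σ = 1 := Equiv.ext fun x => congrFun hσ x
  simp [this]

end Colourings

section TraceIdentities

open Equiv Equiv.Perm Finset

variable {K : Type*} [Field K] {k n : ℕ}

/-- Place permutation of tensors, as a representation on functions of `k`-colourings. -/
def placePermutation (K : Type*) [Field K] (k n : ℕ) :
    Perm (Fin n) →* Module.End K ((Fin n → Fin k) → K) where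
  toFun σ := LinearMap.funLeft K K fun p => p ∘ σ
  map_one' := rfl
  map_mul' _ _ := rfl

/-- The action of the group algebra on tensors. -/
noncomputable def tensorAction (K : Type*) [Field K] (k n : ℕ) :
    MonoidAlgebra K (Perm (Fin n)) →ₐ[K] Module.End K ((Fin n → Fin k) → K) :=
  MonoidAlgebra.lift K _ _ (placePermutation K k n)

theorem tensorAction_sum_single_apply {ι : Type*} (s : Finset ι) (g : ι → Perm (Fin n))
    (α : ι → K) (φ : (Fin n → Fin k) → K) (p : Fin n → Fin k) :
    tensorAction K k n (∑ i ∈ s, MonoidAlgebra.single (g i) (α i)) φ p =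
      ∑ i ∈ s, α i * φ (p ∘ g i) := by
  simp [tensorAction, MonoidAlgebra.lift_single, placePermutation, LinearMap.funLeft]

theorem permTrace_single (σ : Perm (Fin n)) (p q : Fin n → Fin k) :
    permTrace σ (fun i => Matrix.single (p i) (q i) (1 : K)) = if p ∘ σ = q then 1 else 0 := by
  unfold permTrace
  rw [sum_eq_single p]
  · simp [Matrix.single_apply, prod_ite_zero, funext_iff, eq_comm]
  · intro j _ hj
    obtain ⟨i, hi⟩ := Function.ne_iff.1 hj
    exact prod_eq_zero (mem_univ i) (by simp [hi.symm])
  · simp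

theorem sum_permTrace_eq_zero_iff (α : Perm (Fin n) → K) :
    (∀ a : Fin n → Matrix (Fin k) (Fin k) K, ∑ σ, α σ * permTrace σ a = 0) ↔
      tensorAction K k n (∑ σ, MonoidAlgebra.single σ (α σ)) = 0 := by
  constructor
  · intro h
    refine LinearMap.ext fun φ => funext fun p => ?_
    rw [tensorAction_sum_single_apply]
    have hφ : ∀ σ : Perm (Fin n), α σ * φ (p ∘ σ) =
        ∑ q, φ q * (α σ * permTrace σ fun i => Matrix.single (p i) (q i) (1 : K)) := by
      intro σ
      simp [permTrace_single, mul_comm]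
    simp_rw [hφ]
    rw [sum_comm]
    simp [← mul_sum, h]
  · intro h a
    simp_rw [permTrace, mul_sum]
    rw [sum_comm]
    refine sum_eq_zero fun j _ => ?_
    have := congrFun (LinearMap.congr_fun h fun q => ∏ i, a i (j i) (q i)) j
    rwa [tensorAction_sum_single_apply] at this

theorem sum_viaEmbedding_eq_antisymmetrizer {X : Type*} [Fintype X] [DecidableEq X] {m : ℕ}
    (ι : Fin m ↪ X) :
    ∑ τ : Perm (Fin m), MonoidAlgebra.single (τ.viaEmbedding ι) ((sign τ : ℤ) : K) =
      antisymmetrizer (MonoidAlgebra.of K (Perm X)) (univ.map ι) := by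
  have hmem : ∀ x, x ∉ univ.map ι ↔ x ∉ Set.range ι := by simp
  refine sum_bij (fun τ _ => τ.viaEmbedding ι) ?_ ?_ ?_ ?_
  · intro τ _
    simp only [mem_filter, mem_univ, true_and]
    exact fun x hx => viaEmbedding_apply_of_notMem τ ι x ((hmem x).1 hx)
  · intro τ _ τ' _ h
    exact viaEmbeddingHom_injective ι h
  · intro σ hσ
    simp only [mem_filter, mem_univ, true_and] at hσ
    have hσι : ∀ x, σ x ∈ Set.range ι ↔ x ∈ Set.range ι := by
      intro x
      refine Iff.symm ⟨?_, ?_⟩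
      · intro hx
        by_contra h
        have := σ.injective (hσ _ ((hmem _).2 h))
        exact h (this.symm ▸ hx)
      · intro hx
        by_contra h
        rw [hσ x ((hmem x).2 h)] at hx
        exact h hx
    refine ⟨(ofInjective ι ι.injective).symm.permCongr (σ.subtypePerm hσι), mem_univ _, ?_⟩
    ext x
    by_cases hx : x ∈ Set.range ι
    · obtain ⟨y, rfl⟩ := hx
      rw [viaEmbedding_apply]
      simp [Equiv.permCongr_apply, apply_ofInjective_symm]
    · rw [viaEmbedding_apply_of_notMem _ _ _ hx, hσ x ((hmem x).2 hx)]
  · intro τ _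
    have : sign (τ.viaEmbedding ι) = sign τ := by
      classical
      rw [viaEmbedding]
      convert sign_extendDomain τ (ofInjective ι.1 ι.2)
    rw [this, MonoidAlgebra.of_apply, ← zsmul_eq_mul, MonoidAlgebra.smul_single]
    simp

theorem tensorAction_antisymmetrizer (ι : Fin (k + 1) ↪ Fin n) :
    tensorAction K k n (∑ τ : Perm (Fin (k + 1)),
      MonoidAlgebra.single (τ.viaEmbedding ι) ((sign τ : ℤ) : K)) = 0 := by
  refine LinearMap.ext fun φ => funext fun p => ?_
  rw [tensorAction_sum_single_apply]
  obtain ⟨x, y, hxy, hp⟩ := Fintype.exists_ne_map_eq_of_card_lt (p ∘ ι) (by simp)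
  have hinv : ∀ τ : Perm (Fin (k + 1)),
      p ∘ (swap x y * τ).viaEmbedding ι = p ∘ τ.viaEmbedding ι := by
    intro τ
    funext z
    by_cases hz : z ∈ Set.range ι
    · obtain ⟨w, rfl⟩ := hz
      simp only [Function.comp_apply, viaEmbedding_apply, Perm.mul_apply] at hp ⊢
      rw [swap_apply_def]
      split_ifs with h1 h2
      · rw [h1, hp]
      · rw [h2, hp]
      · rfl
    · simp [viaEmbedding_apply_of_notMem _ _ _ hz]
  refine sum_involution (fun τ _ => swap x y * τ) ?_ ?_ ?_ ?_
  · intro τ _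
    rw [hinv]
    simp [sign_swap hxy]
  · intro τ _ _ h
    exact hxy (swap_eq_one_iff.1 (mul_eq_right.1 h))
  · simp
  · intro τ _
    simp [← mul_assoc]

theorem symmetrizer_mul_eq_zero_of_tensorAction_eq_zero (α : Perm (Fin n) → K)
    (h : tensorAction K k n (∑ σ, MonoidAlgebra.single σ (α σ)) = 0) (g : Fin n → Fin k) :
    symmetrizer (MonoidAlgebra.of K (Perm (Fin n))) g * ∑ σ, MonoidAlgebra.single σ (α σ) = 0 := by
  have hsum : symmetrizer (MonoidAlgebra.of K (Perm (Fin n))) g *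
      ∑ σ, MonoidAlgebra.single σ (α σ) =
      ∑ π : Perm (Fin n), MonoidAlgebra.single π (∑ τ with g ∘ (τ : Perm (Fin n)) = g ∘ ⇑π, α τ) := by
    have hr : ∀ π : Perm (Fin n),
        MonoidAlgebra.single π (∑ τ with g ∘ (τ : Perm (Fin n)) = g ∘ ⇑π, α τ) =
        ∑ τ : Perm (Fin n), if g ∘ ⇑τ = g ∘ ⇑π then MonoidAlgebra.single π (α τ) else 0 := by
      intro π
      rw [← sum_filter]
      exact map_sum (MonoidAlgebra.singleAddHom π) _ _
    simp_rw [hr]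
    rw [sum_comm, mul_sum]
    refine sum_congr rfl fun τ _ => ?_
    rw [symmetrizer, sum_mul, sum_filter]
    refine Fintype.sum_equiv (Equiv.mulRight τ) _ _ fun σ => ?_
    have : g ∘ ⇑σ = g ↔ g ∘ ⇑τ = g ∘ ⇑(σ * τ) := by
      rw [Perm.coe_mul, ← Function.comp_assoc]
      exact ⟨fun e => by rw [e], fun e => (τ.surjective.injective_comp_right e).symm⟩
    by_cases hσ : g ∘ ⇑σ = g
    · rw [if_pos hσ, Equiv.coe_mulRight, if_pos (this.1 hσ)]
      simp [MonoidAlgebra.single_mul_single]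
    · rw [if_neg hσ, Equiv.coe_mulRight, if_neg (mt this.2 hσ)]
  rw [hsum]
  refine sum_eq_zero fun π _ => ?_
  have := congrFun (LinearMap.congr_fun h (Pi.single (g ∘ π) 1)) g
  rw [tensorAction_sum_single_apply] at this
  rw [sum_filter]
  simp only [Pi.single_apply, mul_ite, mul_one, mul_zero] at this
  rw [this]
  simp

/-- An element of the group algebra acts as zero on tensors in dimension `k` if and only if it lies
in the two-sided ideal generated by an antisymmetrizer of `k + 1` letters. -/
theorem tensorAction_eq_zero_iff_mem_span [CharZero K] (hn : k + 1 ≤ n) (α : Perm (Fin n) → K) :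
    tensorAction K k n (∑ σ, MonoidAlgebra.single σ (α σ)) = 0 ↔
      (∑ σ, MonoidAlgebra.single σ (α σ)) ∈ TwoSidedIdeal.span
        ({∑ τ : Perm (Fin (k + 1)), MonoidAlgebra.single (τ.viaEmbedding (Fin.castLEEmb hn))
          ((sign τ : ℤ) : K)} : Set (MonoidAlgebra K (Perm (Fin n)))) := by
  set gen : MonoidAlgebra K (Perm (Fin n)) := ∑ τ : Perm (Fin (k + 1)),
    MonoidAlgebra.single (τ.viaEmbedding (Fin.castLEEmb hn)) ((sign τ : ℤ) : K) with hgen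
  constructor
  · intro h
    set I := TwoSidedIdeal.span ({gen} : Set (MonoidAlgebra K (Perm (Fin n)))) with hI
    have hgenI : gen ∈ I := TwoSidedIdeal.subset_span rfl
    have hker : ∀ x, I.ringCon.mk' x = 0 ↔ x ∈ I := fun x => by
      rw [← TwoSidedIdeal.mem_ker, TwoSidedIdeal.ker_ringCon_mk']
    rw [← hker]
    refine eq_zero_of_symmetrizer_mul_eq_zero (k := k) (fun m hm => ?_)
      ((I.ringCon.mk' : _ →* _).comp (MonoidAlgebra.of K (Perm (Fin n))))
      (fun S hS => ?_) _ fun g => ?_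
    · have := ((IsUnit.mk0 (m : K) (Nat.cast_ne_zero.2 hm)).map
        (algebraMap K (MonoidAlgebra K (Perm (Fin n))))).map I.ringCon.mk'
      simpa using this
    · rw [← map_antisymmetrizer, hker]
      have hcard : #(univ.map (Fin.castLEEmb hn)) = #S := by simp [hS]
      obtain ⟨g, rfl⟩ : ∃ g : Perm (Fin n),
          (univ.map (Fin.castLEEmb hn)).map g.toEmbedding = S := by
        refine ⟨(Finset.equivOfCardEq hcard).extendSubtype, eq_of_subset_of_card_le ?_ ?_⟩
        · intro x hx
          obtain ⟨y, hy, rfl⟩ := mem_map.1 hx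
          exact (Finset.equivOfCardEq hcard).extendSubtype_mem y hy
        · rw [card_map, hcard]
      rw [antisymmetrizer_map, ← sum_viaEmbedding_eq_antisymmetrizer]
      exact I.mul_mem_right _ _ (I.mul_mem_left _ _ hgenI)
    · rw [← map_symmetrizer, ← map_mul, symmetrizer_mul_eq_zero_of_tensorAction_eq_zero α h g,
        map_zero]
  · intro h
    have hle : TwoSidedIdeal.span {gen} ≤ TwoSidedIdeal.ker (tensorAction K k n) := by
      rw [TwoSidedIdeal.span_le, Set.singleton_subset_iff]
      exact (TwoSidedIdeal.mem_ker _).2 (tensorAction_antisymmetrizer _)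
    exact (TwoSidedIdeal.mem_ker _).1 (hle h)

end TraceIdentities

/-- **Second Fundamental Theorem of Matrix Invariants (Helling–Razmyslov–Procesi).**
A multilinear trace identity `∑_σ α_σ tr_σ(a_1,…,a_n) = 0` holds on `M_k(K)` if and only if
`∑_σ α_σ σ` lies in the two-sided ideal of the group algebra `K S_n` generated by
`∑_{σ ∈ S_{k+1}} sign(σ) σ`, where `S_{k+1} ⊆ S_n` consists of the permutations fixing
`k+2,…,n`. -/
theorem helling_razmyslov_procesi {K : Type*} [Field K] [IsAlgClosed K] [CharZero K]
    {k n : ℕ} (hn : k + 1 ≤ n) (α : Equiv.Perm (Fin n) → K) :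
    (∀ a : Fin n → Matrix (Fin k) (Fin k) K,
        ∑ σ : Equiv.Perm (Fin n), α σ * permTrace σ a = 0) ↔
      (∑ σ : Equiv.Perm (Fin n), MonoidAlgebra.single σ (α σ)) ∈
        TwoSidedIdeal.span
          ({∑ τ : Equiv.Perm (Fin (k + 1)),
              MonoidAlgebra.single
                (τ.viaEmbedding (Fin.castLEEmb hn))
                (((Equiv.Perm.sign τ : ℤ) : K))} :
            Set (MonoidAlgebra K (Equiv.Perm (Fin n)))) := by
  rw [sum_permTrace_eq_zero_iff]
  exact tensorAction_eq_zero_iff_mem_span hn α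
end
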